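/- arXiv:2601.21620 — 2 statements merged into one kernel-verified Lean document; each statement's English description precedes it below -/
import Mathlib

section
/- Let d ≥ 1, γ ≥ 0 and for an integer M ≥ 1 define C_{q,p}(M) = sup over nonzero finitely supported sequences (c_n)_{n∈ℤ^d} with c_n = 0 for |n| > M of ‖ Σ_{|n|≤M} c_n e^{2πi⟨x,n⟩} ‖_{L^q([0,1]^d)} / ( Σ_{|n|≤M} |c_n|^p (1+|n|)^{pγ} )^{1/p}. Then, with implied constants independent of M: (i) for 2 ≤ q < p ≤ ∞, C_{q,p}(M) ≈ M^{−γ + d(1 − 1/p − 1/q)} if γ < d(1 − 1/p − 1/q), ≈ (log(M+1))^{1/q − 1/p} if γ = d(1 − 1/p − 1/q), and ≈ 1 if γ > d(1 − 1/p − 1/q); (ii) for 1 ≤ q < 2 and any 1 ≤ p ≤ ∞, C_{q,p}(M) ≈ C_{2,p}(M). -/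
open MeasureTheory
open scoped ENNReal Real

/-- Euclidean norm of an integer lattice point `n ∈ ℤ^d`. -/
noncomputable def zNorm {d : ℕ} (n : Fin d → ℤ) : ℝ :=
  Real.sqrt (∑ i, ((n i : ℝ)) ^ 2)

/-- The trigonometric polynomial `Σ_n c_n e^{2πi⟨x,n⟩}` associated with a finitely
supported sequence of real coefficients. -/
noncomputable def trigPoly {d : ℕ} (c : (Fin d → ℤ) → ℝ) (x : Fin d → ℝ) : ℂ :=
  ∑ᶠ n : Fin d → ℤ, (c n : ℂ) *
    Complex.exp (2 * (π : ℂ) * Complex.I * (∑ i, (x i : ℂ) * (n i : ℂ)))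

/-- The best constant `C_{q,p}(M)` in the local uncertainty inequality for
trigonometric polynomials with frequencies `|n| ≤ M` and weight `(1+|n|)^γ`. -/
noncomputable def trigConst (d : ℕ) (γ : ℝ) (q p : ℝ≥0∞) (M : ℕ) : ℝ≥0∞ :=
  ⨆ c : {c : (Fin d → ℤ) → ℝ // c ≠ 0 ∧ (Function.support c).Finite ∧
      ∀ n, (M : ℝ) < zNorm n → c n = 0},
    eLpNorm (trigPoly c.1) q
        (volume.restrict (Set.univ.pi fun _ : Fin d => Set.Icc (0:ℝ) 1)) /
      eLpNorm (fun n => c.1 n * (1 + zNorm n) ^ γ) p Measure.count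

/-- Two-sided comparison `c·g ≤ X ≤ C·g`. -/
def Approx (X : ℝ≥0∞) (c C g : ℝ) : Prop :=
  ENNReal.ofReal (c * g) ≤ X ∧ X ≤ ENNReal.ofReal (C * g)

namespace TrigConst

variable {d : ℕ}

/-- The character `x ↦ e^{2πi⟨x,n⟩}`. -/
noncomputable def char (n : Fin d → ℤ) (x : Fin d → ℝ) : ℂ :=
  Complex.exp (2 * (π : ℂ) * Complex.I * (∑ i, (x i : ℂ) * (n i : ℂ)))

/-- Lebesgue measure on the unit cube. -/
noncomputable def cubeMeasure (d : ℕ) : Measure (Fin d → ℝ) :=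
  volume.restrict (Set.univ.pi fun _ : Fin d => Set.Icc (0:ℝ) 1)

lemma cubeMeasure_eq_pi :
    cubeMeasure d = Measure.pi fun _ : Fin d => (volume.restrict (Set.Icc (0:ℝ) 1)) :=
  Measure.restrict_pi_pi (fun _ : Fin d => (volume : Measure ℝ)) _

instance : IsProbabilityMeasure (cubeMeasure d) := by
  constructor
  rw [cubeMeasure, Measure.restrict_apply_univ, volume_pi_pi]
  simp

lemma char_eq_prod (n : Fin d → ℤ) (x : Fin d → ℝ) :
    char n x = ∏ i, Complex.exp (2 * (π : ℂ) * Complex.I * n i * x i) := by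
  rw [char, ← Complex.exp_sum, Finset.mul_sum]
  congr 1
  exact Finset.sum_congr rfl fun i _ => by ring

lemma char_eq_exp_ofReal (n : Fin d → ℤ) (x : Fin d → ℝ) :
    char n x = Complex.exp (((2 * π * ∑ i, x i * n i : ℝ) : ℂ) * Complex.I) := by
  rw [char]
  push_cast
  congr 1
  ring

lemma norm_char (n : Fin d → ℤ) (x : Fin d → ℝ) : ‖char n x‖ = 1 := by
  rw [char_eq_exp_ofReal, Complex.norm_exp_ofReal_mul_I]

lemma char_re (n : Fin d → ℤ) (x : Fin d → ℝ) :
    (char n x).re = Real.cos (2 * π * ∑ i, x i * n i) := by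
  rw [char_eq_exp_ofReal, Complex.exp_ofReal_mul_I_re]

lemma char_sub (n m : Fin d → ℤ) (x : Fin d → ℝ) :
    char (n - m) x = char n x * star (char m x) := by
  rw [char_eq_exp_ofReal, char_eq_exp_ofReal, char_eq_exp_ofReal, Complex.star_def,
    ← Complex.exp_conj, ← Complex.exp_add]
  congr 1
  simp only [map_mul, Complex.conj_ofReal, Complex.conj_I, Pi.sub_apply, Int.cast_sub, mul_sub,
    Finset.sum_sub_distrib]
  push_cast
  ring

@[fun_prop]
lemma continuous_char (n : Fin d → ℤ) : Continuous (char n) := by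
  unfold char
  fun_prop

lemma integrable_of_continuous {E : Type*} [NormedAddCommGroup E] {f : (Fin d → ℝ) → E}
    (hf : Continuous f) : Integrable f (cubeMeasure d) :=
  (hf.continuousOn.integrableOn_compact (isCompact_univ_pi fun _ => isCompact_Icc))

lemma integral_char (n : Fin d → ℤ) :
    ∫ x, char n x ∂cubeMeasure d = if n = 0 then 1 else 0 := by
  simp_rw [char_eq_prod, cubeMeasure_eq_pi]
  rw [integral_fintype_prod_eq_prod
    (fun i (t : ℝ) => Complex.exp (2 * (π : ℂ) * Complex.I * n i * t))]
  have key : ∀ i, ∫ t in Set.Icc (0:ℝ) 1, Complex.exp (2 * (π : ℂ) * Complex.I * n i * t)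
      = if n i = 0 then 1 else 0 := by
    intro i
    rw [integral_Icc_eq_integral_Ioc, ← intervalIntegral.integral_of_le zero_le_one]
    split_ifs with h
    · simp [h]
    · have hc : 2 * (π : ℂ) * Complex.I * n i ≠ 0 :=
        mul_ne_zero Complex.two_pi_I_ne_zero (by exact_mod_cast h)
      rw [integral_exp_mul_complex hc]
      have : Complex.exp (2 * (π : ℂ) * Complex.I * n i * (1 : ℝ)) = 1 := by
        rw [Complex.exp_eq_one_iff]
        exact ⟨n i, by push_cast; ring⟩
      rw [this]
      simp
  simp_rw [key]
  split_ifs with h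
  · simp [h]
  · obtain ⟨i, hi⟩ := Function.ne_iff.mp h
    exact Finset.prod_eq_zero (Finset.mem_univ i) (if_neg hi)

/-- The trigonometric polynomial with coefficients `c` and frequencies in `s`. -/
noncomputable def partialSum (s : Finset (Fin d → ℤ)) (c : (Fin d → ℤ) → ℝ)
    (x : Fin d → ℝ) : ℂ :=
  ∑ n ∈ s, (c n : ℂ) * char n x

@[fun_prop]
lemma continuous_partialSum (s : Finset (Fin d → ℤ)) (c : (Fin d → ℤ) → ℝ) :
    Continuous (partialSum s c) := by
  unfold partialSum
  fun_prop

lemma trigPoly_eq_partialSum {s : Finset (Fin d → ℤ)} {c : (Fin d → ℤ) → ℝ}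
    (h : ∀ n, c n ≠ 0 → n ∈ s) : trigPoly c = partialSum s c := by
  ext x
  refine finsum_eq_sum_of_support_subset _ fun n hn => h n ?_
  simp only [Function.mem_support] at hn
  intro h0
  exact hn (by simp [h0])

lemma norm_partialSum_le (s : Finset (Fin d → ℤ)) (c : (Fin d → ℤ) → ℝ) (x : Fin d → ℝ) :
    ‖partialSum s c x‖ ≤ ∑ n ∈ s, |c n| :=
  (norm_sum_le _ _).trans (Finset.sum_le_sum fun n _ => by simp [norm_char])

/-- Parseval's identity on the cube. -/
lemma integral_norm_sq_partialSum (s : Finset (Fin d → ℤ)) (c : (Fin d → ℤ) → ℝ) :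
    ∫ x, ‖partialSum s c x‖ ^ 2 ∂cubeMeasure d = ∑ n ∈ s, c n ^ 2 := by
  have h1 : ∀ x, ((‖partialSum s c x‖ ^ 2 : ℝ) : ℂ)
      = ∑ n ∈ s, ∑ m ∈ s, (c n * c m : ℂ) * char (n - m) x := by
    intro x
    have hs : star (partialSum s c x) = ∑ m ∈ s, (c m : ℂ) * star (char m x) := by
      simp [partialSum]
    push_cast
    rw [← Complex.mul_conj', ← Complex.star_def, hs, partialSum, Finset.sum_mul_sum]
    refine Finset.sum_congr rfl fun n _ => Finset.sum_congr rfl fun m _ => ?_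
    rw [char_sub]
    ring
  have h2 : ((∫ x, ‖partialSum s c x‖ ^ 2 ∂cubeMeasure d : ℝ) : ℂ)
      = ((∑ n ∈ s, c n ^ 2 : ℝ) : ℂ) := by
    rw [← integral_complex_ofReal]
    simp_rw [h1]
    rw [integral_finsetSum _ fun n _ => integrable_of_continuous (by fun_prop)]
    push_cast
    refine Finset.sum_congr rfl fun n hn => ?_
    rw [integral_finsetSum _ fun m _ => integrable_of_continuous (by fun_prop)]
    simp_rw [integral_const_mul, integral_char, sub_eq_zero]
    simp [hn, sq]
  exact_mod_cast h2

lemma eLpNorm_eq_integral {f : (Fin d → ℝ) → ℂ} (hf : Continuous f) {q : ℝ≥0∞} (hq0 : q ≠ 0)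
    (hq : q ≠ ⊤) : eLpNorm f q (cubeMeasure d) =
      ENNReal.ofReal ((∫ x, ‖f x‖ ^ q.toReal ∂cubeMeasure d) ^ q.toReal⁻¹) := by
  refine MemLp.eLpNorm_eq_integral_rpow_norm hq0 hq ?_
  have h := integrable_of_continuous (E := ℝ)
    (hf.norm.rpow_const fun x => Or.inr (ENNReal.toReal_nonneg (a := q)))
  exact (integrable_norm_rpow_iff hf.aestronglyMeasurable hq0 hq).mp h

lemma norm_add_pow_four_add_norm_sub_pow_four_le (a b : ℂ) :
    ‖a + b‖ ^ 4 + ‖a - b‖ ^ 4 ≤ 2 * (‖a‖ ^ 4 + 6 * ‖a‖ ^ 2 * ‖b‖ ^ 2 + ‖b‖ ^ 4) := by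
  have h1 := norm_sub_sq_real a b
  have h2 := norm_add_sq_real a b
  have h3 := abs_real_inner_le_norm a b
  have h4 := sq_le_sq' (by linarith [neg_abs_le (inner ℝ a b)]) (le_of_abs_le h3)
  have e1 : ‖a + b‖ ^ 4 = (‖a + b‖ ^ 2) ^ 2 := by ring
  have e2 : ‖a - b‖ ^ 4 = (‖a - b‖ ^ 2) ^ 2 := by ring
  rw [e1, e2, h1, h2]
  nlinarith

/-- A choice of signs for which the fourth moment is controlled by the second one. -/
lemma exists_sign_integral_pow_four_le (s : Finset (Fin d → ℤ)) (c : (Fin d → ℤ) → ℝ) :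
    ∃ ε : (Fin d → ℤ) → ℝ, (∀ n, |ε n| = 1) ∧
      ∫ x, ‖partialSum s (fun n => ε n * c n) x‖ ^ 4 ∂cubeMeasure d
        ≤ 3 * (∑ n ∈ s, c n ^ 2) ^ 2 := by
  classical
  induction s using Finset.induction_on with
  | empty => exact ⟨fun _ => 1, by simp, by simp [partialSum]⟩
  | insert m s hm ih =>
    obtain ⟨ε, hε, hI⟩ := ih
    set S := partialSum s (fun n => ε n * c n) with hS
    have hSc : Continuous S := continuous_partialSum _ _
    set b : (Fin d → ℝ) → ℂ := fun x => (c m : ℂ) * char m x with hb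
    have hbc : Continuous b := by fun_prop
    have hbn : ∀ x, ‖b x‖ = |c m| := fun x => by simp [hb, norm_char]
    have hS2 : ∫ x, ‖S x‖ ^ 2 ∂cubeMeasure d = ∑ n ∈ s, c n ^ 2 := by
      rw [hS, integral_norm_sq_partialSum]
      exact Finset.sum_congr rfl fun n _ => by rw [mul_pow, ← sq_abs (ε n), hε]; ring
    have hupd : ∀ δ : ℝ, partialSum (insert m s) (fun n => Function.update ε m δ n * c n)
        = fun x => δ * b x + S x := by
      intro δ
      ext x
      rw [partialSum, Finset.sum_insert hm, Function.update_self, hS, partialSum]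
      congr 1
      · simp [hb, mul_assoc]
      · refine Finset.sum_congr rfl fun n hn => ?_
        rw [Function.update_of_ne (ne_of_mem_of_not_mem hn hm)]
    have hsum : ∫ x, ‖S x + b x‖ ^ 4 ∂cubeMeasure d + ∫ x, ‖S x - b x‖ ^ 4 ∂cubeMeasure d
        ≤ 2 * (3 * (∑ n ∈ insert m s, c n ^ 2) ^ 2) := by
      rw [← integral_add (integrable_of_continuous (by fun_prop))
        (integrable_of_continuous (by fun_prop))]
      calc _ ≤ ∫ x, (2 * ‖S x‖ ^ 4 + (12 * c m ^ 2 * ‖S x‖ ^ 2 + 2 * c m ^ 4)) ∂cubeMeasure d := by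
            refine integral_mono (integrable_of_continuous (by fun_prop))
              (integrable_of_continuous (by fun_prop)) fun x => ?_
            have h := norm_add_pow_four_add_norm_sub_pow_four_le (S x) (b x)
            have h4 : |c m| ^ 4 = c m ^ 4 := by rw [← abs_pow]; exact abs_of_nonneg (by positivity)
            rw [hbn, sq_abs, h4] at h
            simp only
            linarith
        _ = 2 * ∫ x, ‖S x‖ ^ 4 ∂cubeMeasure d + (12 * c m ^ 2 * ∑ n ∈ s, c n ^ 2 + 2 * c m ^ 4) := by
            rw [integral_add (integrable_of_continuous (by fun_prop))
              (integrable_of_continuous (by fun_prop)), integral_add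
              (integrable_of_continuous (by fun_prop)) (integrable_of_continuous (by fun_prop)),
              integral_const_mul, integral_const_mul, hS2]
            simp
        _ ≤ _ := by
            rw [Finset.sum_insert hm]
            nlinarith [sq_nonneg (c m ^ 2)]
    have hpos : ∀ x, ((1 : ℝ) : ℂ) * b x + S x = S x + b x := fun x => by push_cast; ring
    have hneg : ∀ x, ‖((-1 : ℝ) : ℂ) * b x + S x‖ = ‖S x - b x‖ := fun x => by
      congr 1; push_cast; ring
    have hup : ∀ δ : ℝ, |δ| = 1 → ∀ n, |Function.update ε m δ n| = 1 := by
      intro δ hδ n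
      by_cases h : n = m
      · subst h; simpa using hδ
      · simpa [Function.update_of_ne h] using hε n
    by_cases hcase : ∫ x, ‖S x + b x‖ ^ 4 ∂cubeMeasure d ≤ 3 * (∑ n ∈ insert m s, c n ^ 2) ^ 2
    · refine ⟨Function.update ε m 1, hup 1 (by simp), ?_⟩
      simpa only [hupd, hpos] using hcase
    · refine ⟨Function.update ε m (-1), hup (-1) (by simp), ?_⟩
      simp only [hupd, hneg]
      linarith

lemma exists_sign_sqrt_le (s : Finset (Fin d → ℤ)) (c : (Fin d → ℤ) → ℝ) :
    ∃ ε : (Fin d → ℤ) → ℝ, (∀ n, |ε n| = 1) ∧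
      √(∑ n ∈ s, c n ^ 2) ≤
        5 * ∫ x, ‖partialSum s (fun n => ε n * c n) x‖ ∂cubeMeasure d := by
  obtain ⟨ε, hε, h4⟩ := exists_sign_integral_pow_four_le s c
  refine ⟨ε, hε, ?_⟩
  set T := partialSum s (fun n => ε n * c n) with hT
  have hTc : Continuous T := continuous_partialSum _ _
  have hsum : 0 ≤ ∑ n ∈ s, c n ^ 2 := Finset.sum_nonneg fun n _ => sq_nonneg _
  set σ := √(∑ n ∈ s, c n ^ 2) with hσ
  have hσ2 : σ ^ 2 = ∑ n ∈ s, c n ^ 2 := Real.sq_sqrt hsum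
  have h2 : ∫ x, ‖T x‖ ^ 2 ∂cubeMeasure d = σ ^ 2 := by
    rw [hT, integral_norm_sq_partialSum, hσ2]
    exact Finset.sum_congr rfl fun n _ => by rw [mul_pow, ← sq_abs (ε n), hε]; ring
  have hσ0 : 0 ≤ σ := Real.sqrt_nonneg _
  rcases hσ0.eq_or_lt with h0 | hpos
  · rw [← h0]
    exact mul_nonneg (by norm_num) (integral_nonneg fun x => norm_nonneg _)
  have hpt : ∀ t : ℝ, 0 ≤ t → 9 * σ ^ 2 * t ^ 2 ≤ 27 * σ ^ 3 * t + t ^ 4 := by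
    intro t ht
    rcases le_total t (3 * σ) with h | h
    · have := mul_nonneg (mul_nonneg (sq_nonneg σ) ht) (sub_nonneg.mpr h)
      nlinarith [pow_nonneg ht 4]
    · have h9 : 9 * σ ^ 2 ≤ t ^ 2 := by nlinarith
      nlinarith [mul_le_mul_of_nonneg_right h9 (sq_nonneg t),
        mul_nonneg (pow_nonneg hpos.le 3) ht]
  have hint : ∫ x, 9 * σ ^ 2 * ‖T x‖ ^ 2 ∂cubeMeasure d
      ≤ ∫ x, (27 * σ ^ 3 * ‖T x‖ + ‖T x‖ ^ 4) ∂cubeMeasure d :=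
    integral_mono (integrable_of_continuous (by fun_prop))
      (integrable_of_continuous (by fun_prop)) fun x => hpt _ (norm_nonneg _)
  rw [integral_add (integrable_of_continuous (by fun_prop))
    (integrable_of_continuous (by fun_prop)), integral_const_mul, integral_const_mul, h2] at hint
  rw [← hσ2] at h4
  have h3 : 0 < σ ^ 3 := by positivity
  have : σ ^ 3 * (6 * σ) ≤ σ ^ 3 * (27 * ∫ x, ‖T x‖ ∂cubeMeasure d) := by nlinarith
  have := le_of_mul_le_mul_left this h3
  have hI : 0 ≤ ∫ x, ‖T x‖ ∂cubeMeasure d := integral_nonneg fun x => norm_nonneg _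
  linarith

lemma trigConst_mono_exponent (γ : ℝ) {q₁ q₂ : ℝ≥0∞} (h : q₁ ≤ q₂) (p : ℝ≥0∞) (M : ℕ) :
    trigConst d γ q₁ p M ≤ trigConst d γ q₂ p M := by
  refine iSup_mono fun c => ENNReal.div_le_div_right ?_ _
  refine eLpNorm_le_eLpNorm_of_exponent_le (μ := cubeMeasure d) h ?_
  rw [trigPoly_eq_partialSum (s := c.2.2.1.toFinset) (by simp)]
  exact (continuous_partialSum _ _).aestronglyMeasurable

lemma trigConst_two_le (γ : ℝ) {q : ℝ≥0∞} (hq : 1 ≤ q) (p : ℝ≥0∞) (M : ℕ) :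
    trigConst d γ 2 p M ≤ 5 * trigConst d γ q p M := by
  refine iSup_le fun ⟨c, hc0, hcf, hcM⟩ => ?_
  obtain ⟨ε, hε, h⟩ := exists_sign_sqrt_le hcf.toFinset c
  have hε0 : ∀ n, ε n ≠ 0 := fun n h0 => by simpa [h0] using hε n
  have hsupp : ∀ n, ε n * c n ≠ 0 → n ∈ hcf.toFinset := fun n hn => by
    simpa using right_ne_zero_of_mul hn
  have hmem : (fun n => ε n * c n) ≠ 0 ∧ (Function.support fun n => ε n * c n).Finite ∧
      ∀ n, (M : ℝ) < zNorm n → ε n * c n = 0 := by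
    refine ⟨?_, hcf.toFinset.finite_toSet.subset hsupp, fun n hn => by simp [hcM n hn]⟩
    obtain ⟨n, hn⟩ := Function.ne_iff.mp hc0
    exact Function.ne_iff.mpr ⟨n, mul_ne_zero (hε0 n) hn⟩
  refine le_trans ?_ (mul_le_mul_right (le_iSup (α := ℝ≥0∞) _ ⟨_, hmem⟩) 5)
  dsimp only
  rw [← mul_div_assoc]
  have hden : eLpNorm (fun n => ε n * c n * (1 + zNorm n) ^ γ) p Measure.count
      = eLpNorm (fun n => c n * (1 + zNorm n) ^ γ) p Measure.count :=
    eLpNorm_congr_norm_ae (.of_forall fun n => by simp [hε])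
  rw [hden]
  refine ENNReal.div_le_div_right ?_ _
  change eLpNorm _ 2 (cubeMeasure d) ≤ 5 * eLpNorm _ q (cubeMeasure d)
  rw [trigPoly_eq_partialSum hsupp, trigPoly_eq_partialSum (s := hcf.toFinset) (by simp)]
  refine le_trans ?_ (mul_le_mul_right (eLpNorm_le_eLpNorm_of_exponent_le hq
    (continuous_partialSum _ _).aestronglyMeasurable) 5)
  rw [eLpNorm_eq_integral (by fun_prop) (by simp) (by simp),
    eLpNorm_eq_integral (by fun_prop) (by simp) (by simp)]
  have h5 : (5 : ℝ≥0∞) = ENNReal.ofReal 5 := by simp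
  rw [h5, ← ENNReal.ofReal_mul (by norm_num)]
  refine ENNReal.ofReal_le_ofReal ?_
  simpa [integral_norm_sq_partialSum, Real.sqrt_eq_rpow] using h

/-- The sup norm of a lattice point. -/
def supNorm (n : Fin d → ℤ) : ℕ := Finset.univ.sup fun i => (n i).natAbs

/-- Lattice points of sup norm at most `k`. -/
noncomputable def box (d k : ℕ) : Finset (Fin d → ℤ) :=
  Fintype.piFinset fun _ => Finset.Icc (-(k : ℤ)) k

/-- The weight `1 + |n|_∞`. -/
def weight (n : Fin d → ℤ) : ℝ := (supNorm n : ℝ) + 1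

lemma natAbs_le_supNorm (n : Fin d → ℤ) (i : Fin d) : (n i).natAbs ≤ supNorm n :=
  Finset.le_sup (f := fun i => (n i).natAbs) (Finset.mem_univ i)

lemma abs_le_supNorm (n : Fin d → ℤ) (i : Fin d) : |(n i : ℝ)| ≤ supNorm n := by
  rw [← Int.cast_abs, Int.abs_eq_natAbs]
  exact_mod_cast natAbs_le_supNorm n i

lemma mem_box {k : ℕ} {n : Fin d → ℤ} : n ∈ box d k ↔ supNorm n ≤ k := by
  simp only [box, Fintype.mem_piFinset, Finset.mem_Icc, supNorm, Finset.sup_le_iff,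
    Finset.mem_univ, true_implies]
  exact forall_congr' fun i => by omega

lemma card_box (d k : ℕ) : (box d k).card = (2 * k + 1) ^ d := by
  rw [box, Fintype.card_piFinset_const, Int.card_Icc]
  congr 1
  omega

lemma weight_pos (n : Fin d → ℤ) : 0 < weight n := by
  unfold weight
  positivity

lemma supNorm_le_zNorm (n : Fin d → ℤ) : (supNorm n : ℝ) ≤ zNorm n := by
  rcases Nat.eq_zero_or_pos (supNorm n) with h | h
  · rw [h, Nat.cast_zero]
    exact Real.sqrt_nonneg _
  · have hne : (Finset.univ : Finset (Fin d)).Nonempty := by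
      by_contra hne
      rw [Finset.not_nonempty_iff_eq_empty] at hne
      simp [supNorm, hne] at h
    obtain ⟨i, -, hi⟩ := Finset.exists_mem_eq_sup _ hne fun i => (n i).natAbs
    have hi' : supNorm n = (n i).natAbs := hi
    refine Real.le_sqrt_of_sq_le ?_
    rw [hi', Nat.cast_natAbs, Int.cast_abs, sq_abs]
    exact Finset.single_le_sum (f := fun i => (n i : ℝ) ^ 2) (fun _ _ => sq_nonneg _)
      (Finset.mem_univ i)

lemma zNorm_le (n : Fin d → ℤ) : zNorm n ≤ d * supNorm n := by
  refine Real.sqrt_le_iff.mpr ⟨by positivity, ?_⟩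
  calc ∑ i, (n i : ℝ) ^ 2 ≤ ∑ _i : Fin d, (supNorm n : ℝ) ^ 2 := Finset.sum_le_sum fun i _ => by
        rw [← sq_abs]
        exact pow_le_pow_left₀ (abs_nonneg _) (abs_le_supNorm n i) 2
    _ = d * (supNorm n : ℝ) ^ 2 := by simp
    _ ≤ (d : ℝ) ^ 2 * (supNorm n : ℝ) ^ 2 := by
        refine mul_le_mul_of_nonneg_right ?_ (sq_nonneg _)
        exact_mod_cast Nat.le_self_pow two_ne_zero d
    _ = _ := by ring

lemma weight_le (n : Fin d → ℤ) : weight n ≤ 1 + zNorm n := by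
  unfold weight
  linarith [supNorm_le_zNorm n]

lemma one_add_zNorm_le (hd : 1 ≤ d) (n : Fin d → ℤ) : 1 + zNorm n ≤ d * weight n := by
  have : (1 : ℝ) ≤ d := by exact_mod_cast hd
  unfold weight
  linarith [zNorm_le n]

lemma mem_box_of_zNorm_le {M : ℕ} {n : Fin d → ℤ} (h : zNorm n ≤ M) : n ∈ box d M :=
  mem_box.mpr (by exact_mod_cast (supNorm_le_zNorm n).trans h)

lemma card_shell_le (hd : 1 ≤ d) (M k : ℕ) :
    (((box d M).filter fun n => supNorm n = k).card : ℝ)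
      ≤ d * 2 ^ d * ((k : ℝ) + 1) ^ ((d : ℝ) - 1) := by
  obtain ⟨e, rfl⟩ := Nat.exists_eq_add_of_le' hd
  have he : (((e + 1 : ℕ) : ℝ) - 1) = (e : ℝ) := by push_cast; ring
  rw [he, Real.rpow_natCast]
  rcases Nat.eq_zero_or_pos k with rfl | hk
  · have : ((box (e + 1) M).filter fun n => supNorm n = 0).card ≤ (box (e + 1) 0).card :=
      Finset.card_le_card fun n hn => mem_box.mpr (Finset.mem_filter.mp hn).2.le
    rw [card_box] at this
    have h1 : (((box (e + 1) M).filter fun n => supNorm n = 0).card : ℝ) ≤ 1 := by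
      exact_mod_cast (by simpa using this)
    refine h1.trans ?_
    have : (1 : ℝ) ≤ 2 ^ (e + 1) := one_le_pow₀ (by norm_num)
    push_cast
    simp only [zero_add, one_pow, mul_one]
    nlinarith [(Nat.cast_nonneg e : (0 : ℝ) ≤ e)]
  · obtain ⟨l, rfl⟩ := Nat.exists_eq_add_of_le' hk
    have hsub : ((box (e + 1) M).filter fun n => supNorm n = l + 1)
        ⊆ box (e + 1) (l + 1) \ box (e + 1) l := fun n hn => by
      have := (Finset.mem_filter.mp hn).2
      rw [Finset.mem_sdiff, mem_box, mem_box]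
      omega
    have hle := Finset.card_le_card hsub
    rw [Finset.card_sdiff_of_subset (fun n hn => by rw [mem_box] at *; omega), card_box, card_box]
      at hle
    have hle' : (((box (e + 1) M).filter fun n => supNorm n = l + 1).card : ℝ)
        ≤ (2 * (l + 1 : ℕ) + 1 : ℝ) ^ (e + 1) - (2 * l + 1 : ℝ) ^ (e + 1) := by
      have hmono : (2 * l + 1) ^ (e + 1) ≤ (2 * (l + 1) + 1) ^ (e + 1) :=
        Nat.pow_le_pow_left (by omega) _
      have := (Nat.cast_le (α := ℝ)).mpr hle
      rw [Nat.cast_sub hmono] at this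
      exact_mod_cast this
    refine hle'.trans ?_
    push_cast
    set y : ℝ := 2 * (l + 1) + 1 with hy
    have hl : (0 : ℝ) ≤ l := Nat.cast_nonneg l
    have hypos : 0 < y := by positivity
    have hb := one_add_mul_le_pow (a := -2 / y) (by rw [le_div_iff₀ hypos]; linarith) (e + 1)
    have hyl : (2 * l + 1 : ℝ) = y * (1 + -2 / y) := by field_simp; rw [hy]; ring
    rw [hyl, mul_pow]
    have h1 := mul_le_mul_of_nonneg_left hb (pow_nonneg hypos.le (e + 1))
    have h2 : y ^ (e + 1) * (1 + ((e + 1 : ℕ) : ℝ) * (-2 / y))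
        = y ^ (e + 1) - 2 * (e + 1) * y ^ e := by
      push_cast
      field_simp
      ring
    have h3 : y ^ e ≤ (2 * ((l : ℝ) + 1 + 1)) ^ e := pow_le_pow_left₀ hypos.le (by linarith) _
    rw [mul_pow] at h3
    rw [h2] at h1
    have h4 := mul_le_mul_of_nonneg_left h3 (by positivity : (0 : ℝ) ≤ 2 * (e + 1))
    calc _ ≤ 2 * ((e : ℝ) + 1) * y ^ e := by linarith
      _ ≤ _ := h4
      _ = _ := by ring

lemma sum_box_le (hd : 1 ≤ d) (k M : ℕ) (a : ℝ) :
    ∑ n ∈ (box d M).filter (fun n => k ≤ supNorm n), weight n ^ a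
      ≤ d * 2 ^ d * ∑ j ∈ Finset.Ico k (M + 1), ((j : ℝ) + 1) ^ ((d : ℝ) + a - 1) := by
  have hmaps : ∀ n ∈ (box d M).filter (fun n => k ≤ supNorm n),
      supNorm n ∈ Finset.Ico k (M + 1) := fun n hn => by
    rw [Finset.mem_filter, mem_box] at hn
    rw [Finset.mem_Ico]
    omega
  rw [← Finset.sum_fiberwise_of_maps_to hmaps, Finset.mul_sum]
  refine Finset.sum_le_sum fun j _ => ?_
  have hj : (0 : ℝ) < (j : ℝ) + 1 := by positivity
  calc _ = ∑ n ∈ ((box d M).filter fun n => k ≤ supNorm n).filter fun n => supNorm n = j,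
          ((j : ℝ) + 1) ^ a := Finset.sum_congr rfl fun n hn => by
        rw [weight, (Finset.mem_filter.mp hn).2]
    _ ≤ ∑ n ∈ (box d M).filter fun n => supNorm n = j, ((j : ℝ) + 1) ^ a :=
        Finset.sum_le_sum_of_subset_of_nonneg
          (Finset.filter_subset_filter _ (Finset.filter_subset _ _)) fun _ _ _ => by positivity
    _ = ((box d M).filter fun n => supNorm n = j).card * ((j : ℝ) + 1) ^ a := by simp
    _ ≤ d * 2 ^ d * ((j : ℝ) + 1) ^ ((d : ℝ) - 1) * ((j : ℝ) + 1) ^ a :=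
        mul_le_mul_of_nonneg_right (card_shell_le hd M j) (by positivity)
    _ = _ := by
        rw [mul_assoc, ← Real.rpow_add hj]
        ring_nf

lemma one_sub_rpow_le {s t : ℝ} (hs : 0 < s) (ht0 : 0 ≤ t) (ht1 : t ≤ 1) :
    (1 - t) ^ s ≤ 1 - min s 1 * t := by
  rcases le_total s 1 with h | h
  · have := rpow_one_add_le_one_add_mul_self (s := -t) (by linarith) hs.le h
    rw [min_eq_left h]
    calc _ = (1 + -t) ^ s := by ring_nf
      _ ≤ _ := this
      _ = _ := by ring
  · rw [min_eq_right h, one_mul]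
    exact Real.rpow_le_self_of_le_one (by linarith) (by linarith) h

lemma sum_range_rpow_le {s : ℝ} (hs : 0 < s) (k : ℕ) :
    min s 1 * ∑ j ∈ Finset.range k, ((j : ℝ) + 1) ^ (s - 1) ≤ (k : ℝ) ^ s := by
  rw [Finset.mul_sum]
  calc _ ≤ ∑ j ∈ Finset.range k, (((j + 1 : ℕ) : ℝ) ^ s - (j : ℝ) ^ s) := by
        refine Finset.sum_le_sum fun j _ => ?_
        have hj : (0 : ℝ) < (j : ℝ) + 1 := by positivity
        have h := one_sub_rpow_le hs (t := 1 / ((j : ℝ) + 1)) (by positivity)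
          (by rw [div_le_one hj]; linarith [(Nat.cast_nonneg j : (0 : ℝ) ≤ j)])
        have h1 : (1 - 1 / ((j : ℝ) + 1)) = j / (j + 1) := by field_simp; ring
        rw [h1, Real.div_rpow (by positivity) hj.le, div_le_iff₀ (by positivity)] at h
        rw [Real.rpow_sub_one hj.ne']
        push_cast
        calc _ = ((j : ℝ) + 1) ^ s - (1 - min s 1 * (1 / (j + 1))) * ((j : ℝ) + 1) ^ s := by
              field_simp; ring
          _ ≤ _ := by linarith
    _ = _ := by
        rw [Finset.sum_range_sub fun j : ℕ => (j : ℝ) ^ s, Nat.cast_zero, Real.zero_rpow hs.ne',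
          sub_zero]

lemma sum_Ico_rpow_le {s : ℝ} (hs : 0 < s) (k K : ℕ) :
    min s 1 * ∑ j ∈ Finset.Ico k K, ((j : ℝ) + 1) ^ (-s - 1) ≤ 2 * ((k : ℝ) + 1) ^ (-s) := by
  rcases le_total K k with hK | hK
  · rw [Finset.Ico_eq_empty_of_le hK]
    simp only [Finset.sum_empty, mul_zero]
    positivity
  rw [Finset.mul_sum]
  calc _ ≤ ∑ j ∈ Finset.Ico k K,
          (-(2 * (((j + 1 : ℕ) : ℝ) + 1) ^ (-s)) - -(2 * ((j : ℝ) + 1) ^ (-s))) := by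
        refine Finset.sum_le_sum fun j _ => ?_
        have hj0 : (0 : ℝ) ≤ j := Nat.cast_nonneg j
        have hj : (0 : ℝ) < (j : ℝ) + 1 := by positivity
        have hj2 : (0 : ℝ) < (j : ℝ) + 1 + 1 := by positivity
        have h := one_sub_rpow_le hs (t := 1 / ((j : ℝ) + 1 + 1)) (by positivity)
          (by rw [div_le_one hj2]; linarith)
        have h1 : (1 - 1 / ((j : ℝ) + 1 + 1)) = (j + 1) / (j + 1 + 1) := by field_simp; ring
        rw [h1, Real.div_rpow hj.le hj2.le, div_eq_mul_inv, ← Real.rpow_neg hj2.le] at h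
        have hm : 0 ≤ min s 1 := le_min hs.le zero_le_one
        have h2 : min s 1 / ((j : ℝ) + 1) ≤ 2 * (min s 1 * (1 / ((j : ℝ) + 1 + 1))) := by
          rw [mul_one_div, ← mul_div_assoc, div_le_div_iff₀ hj hj2]
          nlinarith
        have h3 : ((j : ℝ) + 1) ^ s * ((j : ℝ) + 1) ^ (-s) = 1 := by
          rw [← Real.rpow_add hj, add_neg_cancel, Real.rpow_zero]
        have h4 : (0 : ℝ) < ((j : ℝ) + 1) ^ (-s) := by positivity
        rw [Real.rpow_sub_one hj.ne']
        push_cast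
        calc _ = min s 1 / ((j : ℝ) + 1) * ((j : ℝ) + 1) ^ (-s) := by ring
          _ ≤ 2 * (1 - ((j : ℝ) + 1) ^ s * ((j : ℝ) + 1 + 1) ^ (-s)) * ((j : ℝ) + 1) ^ (-s) :=
              mul_le_mul_of_nonneg_right (by linarith) h4.le
          _ = 2 * ((j : ℝ) + 1) ^ (-s) - 2 * (((j : ℝ) + 1) ^ s * ((j : ℝ) + 1) ^ (-s))
                * ((j : ℝ) + 1 + 1) ^ (-s) := by ring
          _ = _ := by rw [h3]; ring
    _ = -(2 * ((K : ℝ) + 1) ^ (-s)) - -(2 * ((k : ℝ) + 1) ^ (-s)) := by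
        rw [Finset.sum_Ico_sub (fun j : ℕ => -(2 * ((j : ℝ) + 1) ^ (-s))) hK]
    _ ≤ _ := by
        have : 0 ≤ ((K : ℝ) + 1) ^ (-s) := by positivity
        linarith

lemma exists_sum_box_le (hd : 1 ≤ d) {a : ℝ} (ha : 0 < d + a) :
    ∃ C : ℝ, 0 < C ∧ ∀ k : ℕ, ∑ n ∈ box d k, weight n ^ a ≤ C * ((k : ℝ) + 1) ^ (d + a) := by
  have hm : 0 < min (d + a) 1 := lt_min ha one_pos
  have hd' : (0 : ℝ) < d := by exact_mod_cast hd
  refine ⟨d * 2 ^ d / min (d + a) 1, by positivity, fun k => ?_⟩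
  have h1 := sum_box_le hd 0 k a
  have h2 := sum_range_rpow_le ha (k + 1)
  rw [← le_div_iff₀' hm] at h2
  simp only [zero_le, Finset.filter_true, ← Finset.range_eq_Ico] at h1
  push_cast at h2
  calc _ ≤ _ := h1
    _ ≤ _ := mul_le_mul_of_nonneg_left h2 (by positivity)
    _ = _ := by ring

lemma exists_sum_box_tail_le (hd : 1 ≤ d) {a : ℝ} (ha : d + a < 0) :
    ∃ C : ℝ, 0 < C ∧ ∀ k M : ℕ, ∑ n ∈ (box d M).filter (fun n => k ≤ supNorm n), weight n ^ a
      ≤ C * ((k : ℝ) + 1) ^ (d + a) := by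
  have hs : 0 < -(d + a) := by linarith
  have hm : 0 < min (-(d + a)) 1 := lt_min hs one_pos
  have hd' : (0 : ℝ) < d := by exact_mod_cast hd
  refine ⟨d * 2 ^ d * 2 / min (-(d + a)) 1, by positivity, fun k M => ?_⟩
  have h1 := sum_box_le hd k M a
  have h2 := sum_Ico_rpow_le hs k (M + 1)
  rw [← le_div_iff₀' hm, neg_neg] at h2
  calc _ ≤ _ := h1
    _ ≤ _ := mul_le_mul_of_nonneg_left h2 (by positivity)
    _ = _ := by ring

lemma half_le_log {M : ℕ} (hM : 1 ≤ M) : 1 / 2 ≤ Real.log ((M : ℝ) + 1) := by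
  have h1 : (1 : ℝ) ≤ M := by exact_mod_cast hM
  have h2 : Real.log 2 ≤ Real.log ((M : ℝ) + 1) := Real.log_le_log (by norm_num) (by linarith)
  linarith [Real.log_two_gt_d9]

lemma exists_sum_box_le_log (hd : 1 ≤ d) :
    ∃ C : ℝ, 0 < C ∧ ∀ M : ℕ, 1 ≤ M →
      ∑ n ∈ box d M, weight n ^ (-(d : ℝ)) ≤ C * Real.log ((M : ℝ) + 1) := by
  have hd' : (0 : ℝ) < d := by exact_mod_cast hd
  refine ⟨d * 2 ^ d * 3, by positivity, fun M hM => ?_⟩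
  have h1 := sum_box_le hd 0 M (-(d : ℝ))
  simp only [zero_le, Finset.filter_true, ← Finset.range_eq_Ico, add_neg_cancel, zero_sub] at h1
  have h2 := harmonic_le_one_add_log (M + 1)
  have h3 : ((harmonic (M + 1) : ℚ) : ℝ)
      = ∑ j ∈ Finset.range (M + 1), ((j : ℝ) + 1) ^ (-1 : ℝ) := by
    rw [harmonic]
    push_cast
    exact Finset.sum_congr rfl fun j _ => (Real.rpow_neg_one _).symm
  rw [h3] at h2
  push_cast at h2
  have h4 := half_le_log hM
  calc _ ≤ _ := h1
    _ ≤ d * 2 ^ d * (3 * Real.log ((M : ℝ) + 1)) :=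
        mul_le_mul_of_nonneg_left (by linarith) (by positivity)
    _ = _ := by ring

/-- The truncated power used in place of `x ^ r`, vanishing at index zero even if `r = 0`. -/
noncomputable def truncPow (A : ℕ → ℝ) (r : ℝ) (k : ℕ) : ℝ := if k = 0 then 0 else A k ^ r

lemma truncPow_mono {A : ℕ → ℝ} (hA : Monotone A) (hA0 : A 0 = 0) {r : ℝ} (hr : 0 ≤ r) :
    Monotone (truncPow A r) := by
  have hnn : ∀ k, 0 ≤ A k := fun k => hA0 ▸ hA (Nat.zero_le k)
  refine monotone_nat_of_le_succ fun k => ?_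
  unfold truncPow
  rcases Nat.eq_zero_or_pos k with rfl | hk
  · simpa using Real.rpow_nonneg (hnn 1) r
  · simp only [hk.ne', if_false, Nat.succ_ne_zero]
    exact Real.rpow_le_rpow (hnn k) (hA k.le_succ) hr

lemma rpow_le_sum_truncPow {A : ℕ → ℝ} (hA : Monotone A) (hA0 : A 0 = 0) {q t : ℝ} (hq : 2 ≤ q)
    (ht : 0 ≤ t) {K : ℕ} (htK : t ≤ A K) {r : ℕ → ℝ} (hr : ∀ k, t ≤ A k + r k) :
    t ^ q ≤ 2 ^ q * ∑ k ∈ Finset.range K,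
      (truncPow A (q - 2) (k + 1) - truncPow A (q - 2) k) * r k ^ 2 := by
  have hmono := truncPow_mono hA hA0 (sub_nonneg.mpr hq)
  have hΔ : ∀ k, 0 ≤ truncPow A (q - 2) (k + 1) - truncPow A (q - 2) k := fun k =>
    sub_nonneg.mpr (hmono k.le_succ)
  rcases ht.eq_or_lt with rfl | ht
  · rw [Real.zero_rpow (by linarith)]
    exact mul_nonneg (by positivity)
      (Finset.sum_nonneg fun k _ => mul_nonneg (hΔ k) (sq_nonneg _))
  have hex : ∃ k, t / 2 < A k := ⟨K, by linarith⟩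
  classical
  set k₀ := Nat.find hex with hk₀
  have hk₀A : t / 2 < A k₀ := Nat.find_spec hex
  have hk₀K : k₀ ≤ K := Nat.find_min' hex (by linarith)
  have hk₀0 : k₀ ≠ 0 := fun h => by
    rw [h, hA0] at hk₀A
    linarith
  have hlow : (t / 2) ^ q ≤ ∑ k ∈ Finset.range K,
      (truncPow A (q - 2) (k + 1) - truncPow A (q - 2) k) * r k ^ 2 := by
    calc (t / 2) ^ q = (t / 2) ^ (q - 2) * (t / 2) ^ 2 := by
          rw [← Real.rpow_add_natCast (by positivity)]
          norm_num
      _ ≤ truncPow A (q - 2) k₀ * (t / 2) ^ 2 := by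
          refine mul_le_mul_of_nonneg_right ?_ (sq_nonneg _)
          rw [truncPow, if_neg hk₀0]
          exact Real.rpow_le_rpow (by positivity) hk₀A.le (by linarith)
      _ = ∑ k ∈ Finset.range k₀,
            (truncPow A (q - 2) (k + 1) - truncPow A (q - 2) k) * (t / 2) ^ 2 := by
          rw [← Finset.sum_mul, Finset.sum_range_sub]
          simp [truncPow]
      _ ≤ ∑ k ∈ Finset.range k₀,
            (truncPow A (q - 2) (k + 1) - truncPow A (q - 2) k) * r k ^ 2 := by
          refine Finset.sum_le_sum fun k hk => mul_le_mul_of_nonneg_left ?_ (hΔ k)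
          have h1 := not_lt.mp (Nat.find_min hex (Finset.mem_range.mp hk))
          exact pow_le_pow_left₀ (by positivity) (by linarith [hr k]) 2
      _ ≤ _ := Finset.sum_le_sum_of_subset_of_nonneg
          (Finset.range_subset_range.mpr hk₀K) fun k _ _ => mul_nonneg (hΔ k) (sq_nonneg _)
  calc t ^ q = 2 ^ q * (t / 2) ^ q := by
        rw [← Real.mul_rpow (by norm_num) (by positivity)]
        congr 1
        ring
    _ ≤ _ := mul_le_mul_of_nonneg_left hlow (by positivity)

/-- The `L^q` norm, `q ≥ 2`, is controlled by weighting the squared coefficients with powers of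
the partial `ℓ¹` norms. -/
lemma integral_rpow_partialSum_le {q : ℝ} (hq : 2 ≤ q) (M : ℕ) (c : (Fin d → ℤ) → ℝ) :
    ∫ x, ‖partialSum (box d M) c x‖ ^ q ∂cubeMeasure d
      ≤ 2 ^ q * ∑ n ∈ box d M, c n ^ 2 * (∑ m ∈ box d (supNorm n), |c m|) ^ (q - 2) := by
  set A : ℕ → ℝ := fun k => ∑ n ∈ (box d M).filter (fun n => supNorm n < k), |c n| with hAdef
  have hA : Monotone A := fun k l hkl => Finset.sum_le_sum_of_subset_of_nonneg
    (fun n hn => by rw [Finset.mem_filter] at *; exact ⟨hn.1, hn.2.trans_le hkl⟩)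
    fun _ _ _ => abs_nonneg _
  have hA0 : A 0 = 0 := by simp [hAdef]
  set R : ℕ → (Fin d → ℝ) → ℂ := fun k =>
    partialSum ((box d M).filter fun n => k ≤ supNorm n) c with hR
  have hRc : ∀ k, Continuous (R k) := fun k => continuous_partialSum _ _
  have hpt : ∀ x, ‖partialSum (box d M) c x‖ ^ q ≤ 2 ^ q * ∑ k ∈ Finset.range (M + 1),
      (truncPow A (q - 2) (k + 1) - truncPow A (q - 2) k) * ‖R k x‖ ^ 2 := by
    intro x
    refine rpow_le_sum_truncPow hA hA0 hq (norm_nonneg _) ?_ fun k => ?_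
    · refine (norm_partialSum_le _ _ _).trans (Finset.sum_le_sum_of_subset_of_nonneg
        (fun n hn => Finset.mem_filter.mpr ⟨hn, ?_⟩) fun _ _ _ => abs_nonneg _)
      exact Nat.lt_succ_of_le (mem_box.mp hn)
    · have hsplit : partialSum (box d M) c x
          = partialSum ((box d M).filter fun n => supNorm n < k) c x + R k x := by
        rw [hR]
        simp only [partialSum]
        rw [← Finset.sum_filter_add_sum_filter_not (box d M) fun n => supNorm n < k]
        simp only [not_lt]
      rw [hsplit]
      exact (norm_add_le _ _).trans (add_le_add_left (norm_partialSum_le _ _ _) _)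
  calc _ ≤ ∫ x, 2 ^ q * ∑ k ∈ Finset.range (M + 1),
      (truncPow A (q - 2) (k + 1) - truncPow A (q - 2) k) * ‖R k x‖ ^ 2 ∂cubeMeasure d := by
        refine integral_mono (integrable_of_continuous ?_) (integrable_of_continuous ?_) hpt
        · exact (continuous_partialSum _ _).norm.rpow_const fun x => Or.inr (by linarith)
        · fun_prop
    _ = 2 ^ q * ∑ k ∈ Finset.range (M + 1), ∑ n ∈ (box d M).filter (fun n => k ≤ supNorm n),
          (truncPow A (q - 2) (k + 1) - truncPow A (q - 2) k) * c n ^ 2 := by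
        rw [integral_const_mul, integral_finsetSum _ fun k _ =>
          integrable_of_continuous (by fun_prop)]
        congr 1
        refine Finset.sum_congr rfl fun k _ => ?_
        rw [integral_const_mul, hR, integral_norm_sq_partialSum, Finset.mul_sum]
    _ = 2 ^ q * ∑ n ∈ box d M, ∑ k ∈ Finset.range (supNorm n + 1),
          (truncPow A (q - 2) (k + 1) - truncPow A (q - 2) k) * c n ^ 2 := by
        congr 1
        refine Finset.sum_comm' fun k n => ?_
        simp only [Finset.mem_filter, Finset.mem_range, mem_box]
        omega
    _ = _ := by
        congr 1
        refine Finset.sum_congr rfl fun n hn => ?_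
        rw [← Finset.sum_mul, Finset.sum_range_sub, truncPow, truncPow, if_neg (Nat.succ_ne_zero _),
          if_pos rfl, sub_zero, mul_comm]
        congr 3
        refine Finset.sum_congr ?_ fun _ _ => rfl
        ext m
        rw [mem_box] at hn
        simp only [Finset.mem_filter, mem_box]
        omega

lemma rpow_sum_box_le (hd : 1 ≤ d) {q : ℝ} (hq : 2 ≤ q) :
    ∃ C : ℝ, 0 < C ∧ ∀ (k : ℕ) (c : (Fin d → ℤ) → ℝ), (∑ m ∈ box d k, |c m|) ^ q
      ≤ C * ((k : ℝ) + 1) ^ ((d : ℝ) / 2)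
        * ∑ m ∈ box d k, |c m| ^ q * weight m ^ (d * q - 3 * d / 2) := by
  have hd' : (0 : ℝ) < d := by exact_mod_cast hd
  have hq0 : q ≠ 0 := by linarith
  have hq1 : 0 < q - 1 := by linarith
  set ε : ℝ := d * (1 - 3 / (2 * q)) with hε
  set q' : ℝ := q / (q - 1) with hq'
  have hconj : q.HolderConjugate q' := Real.HolderConjugate.conjExponent (by linarith)
  have hexp : (d : ℝ) + -ε * q' = d / 2 / (q - 1) := by
    rw [hε, hq']
    field_simp
    ring
  obtain ⟨C, hC, h⟩ := exists_sum_box_le hd (a := -ε * q') (by rw [hexp]; positivity)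
  refine ⟨C ^ (q - 1), by positivity, fun k c => ?_⟩
  have hw : ∀ m : Fin d → ℤ, 0 < weight m := weight_pos
  have hk : (0 : ℝ) < (k : ℝ) + 1 := by positivity
  have hH := Real.inner_le_Lp_mul_Lq_of_nonneg (box d k) hconj
    (f := fun m => |c m| * weight m ^ ε) (g := fun m => weight m ^ (-ε))
    (fun m _ => mul_nonneg (abs_nonneg _) (Real.rpow_nonneg (hw m).le _))
    (fun m _ => Real.rpow_nonneg (hw m).le _)
  have e1 : ∀ m : Fin d → ℤ, |c m| * weight m ^ ε * weight m ^ (-ε) = |c m| := fun m => by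
    rw [mul_assoc, ← Real.rpow_add (hw m), add_neg_cancel, Real.rpow_zero, mul_one]
  have e2 : ∀ m : Fin d → ℤ, (|c m| * weight m ^ ε) ^ q
      = |c m| ^ q * weight m ^ (d * q - 3 * d / 2) := fun m => by
    rw [Real.mul_rpow (abs_nonneg _) (Real.rpow_nonneg (hw m).le _), ← Real.rpow_mul (hw m).le]
    congr 2
    rw [hε]
    field_simp
  have e3 : ∀ m : Fin d → ℤ, (weight m ^ (-ε)) ^ q' = weight m ^ (-ε * q') := fun m =>
    (Real.rpow_mul (hw m).le _ _).symm
  simp only [e1, e2, e3] at hH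
  have hS1 : 0 ≤ ∑ m ∈ box d k, |c m| ^ q * weight m ^ (d * q - 3 * d / 2) :=
    Finset.sum_nonneg fun m _ => mul_nonneg (Real.rpow_nonneg (abs_nonneg _) _)
      (Real.rpow_nonneg (hw m).le _)
  have hS2 : 0 ≤ ∑ m ∈ box d k, weight m ^ (-ε * q') :=
    Finset.sum_nonneg fun m _ => Real.rpow_nonneg (hw m).le _
  have h1 := Real.rpow_le_rpow (Finset.sum_nonneg fun m _ => abs_nonneg _) hH
    (by linarith : 0 ≤ q)
  rw [Real.mul_rpow (Real.rpow_nonneg hS1 _) (Real.rpow_nonneg hS2 _), ← Real.rpow_mul hS1,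
    ← Real.rpow_mul hS2, one_div_mul_cancel hq0, Real.rpow_one] at h1
  have e4 : 1 / q' * q = q - 1 := by
    rw [hq']
    field_simp
  rw [e4] at h1
  have h2 := Real.rpow_le_rpow hS2 (h k) hq1.le
  rw [hexp, Real.mul_rpow hC.le (by positivity), ← Real.rpow_mul hk.le,
    div_mul_cancel₀ _ hq1.ne'] at h2
  calc _ ≤ _ := h1
    _ ≤ _ := mul_le_mul_of_nonneg_left h2 hS1
    _ = _ := by ring

/-- A discrete Hardy inequality on the lattice. -/
lemma sum_rpow_sum_box_le (hd : 1 ≤ d) {q : ℝ} (hq : 2 ≤ q) :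
    ∃ C : ℝ, 0 < C ∧ ∀ (M : ℕ) (c : (Fin d → ℤ) → ℝ),
      ∑ n ∈ box d M, (∑ m ∈ box d (supNorm n), |c m|) ^ q * weight n ^ (-2 * (d : ℝ))
        ≤ C * ∑ n ∈ box d M, |c n| ^ q * weight n ^ (d * (q - 2)) := by
  have hd' : (0 : ℝ) < d := by exact_mod_cast hd
  obtain ⟨C₁, hC₁, h₁⟩ := rpow_sum_box_le hd hq
  obtain ⟨C₂, hC₂, h₂⟩ := exists_sum_box_tail_le hd (a := -(3 * d / 2 : ℝ)) (by linarith)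
  refine ⟨C₁ * C₂, by positivity, fun M c => ?_⟩
  have hw : ∀ m : Fin d → ℤ, 0 < weight m := weight_pos
  set b : (Fin d → ℤ) → ℝ := fun m => |c m| ^ q * weight m ^ (d * q - 3 * d / 2 : ℝ) with hb
  have hb0 : ∀ m, 0 ≤ b m := fun m => mul_nonneg (Real.rpow_nonneg (abs_nonneg _) _)
    (Real.rpow_nonneg (hw m).le _)
  calc _ ≤ ∑ n ∈ box d M, ∑ m ∈ box d (supNorm n),
          C₁ * (b m * weight n ^ (-(3 * d / 2) : ℝ)) := by
        refine Finset.sum_le_sum fun n _ => ?_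
        refine (mul_le_mul_of_nonneg_right (h₁ (supNorm n) c)
          (Real.rpow_nonneg (hw n).le _)).trans_eq ?_
        have : weight n ^ (-(3 * d / 2) : ℝ)
            = weight n ^ ((d : ℝ) / 2) * weight n ^ (-2 * (d : ℝ)) := by
          rw [← Real.rpow_add (hw n)]
          congr 1
          ring
        rw [← Finset.mul_sum, ← Finset.sum_mul, this]
        simp only [hb, weight]
        ring
    _ = ∑ m ∈ box d M, ∑ n ∈ (box d M).filter (fun n => supNorm m ≤ supNorm n),
          C₁ * (b m * weight n ^ (-(3 * d / 2) : ℝ)) := by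
        refine Finset.sum_comm' fun n m => ?_
        simp only [Finset.mem_filter, mem_box]
        omega
    _ ≤ ∑ m ∈ box d M, C₁ * (b m * (C₂ * weight m ^ ((d : ℝ) + -(3 * d / 2)))) := by
        refine Finset.sum_le_sum fun m _ => ?_
        rw [← Finset.mul_sum, ← Finset.mul_sum]
        exact mul_le_mul_of_nonneg_left
          (mul_le_mul_of_nonneg_left (h₂ (supNorm m) M) (hb0 m)) hC₁.le
    _ = _ := by
        rw [Finset.mul_sum]
        refine Finset.sum_congr rfl fun m _ => ?_
        have : weight m ^ (d * (q - 2) : ℝ)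
            = weight m ^ (d * q - 3 * d / 2 : ℝ) * weight m ^ ((d : ℝ) + -(3 * d / 2)) := by
          rw [← Real.rpow_add (hw m)]
          congr 1
          ring
        rw [this, hb]
        ring

lemma sq_mul_rpow_le {x y q : ℝ} (hx : 0 ≤ x) (hy : 0 ≤ y) (hq : 2 ≤ q) :
    x ^ 2 * y ^ (q - 2) ≤ x ^ q + y ^ q := by
  have key : ∀ z : ℝ, 0 ≤ z → z ^ 2 * z ^ (q - 2) ≤ z ^ q := fun z hz => by
    rcases hz.eq_or_lt with rfl | hz
    · simpa using Real.rpow_nonneg le_rfl q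
    · rw [← Real.rpow_natCast, ← Real.rpow_add hz]
      norm_num
  rcases le_total x y with h | h
  · have h1 := mul_le_mul_of_nonneg_right (pow_le_pow_left₀ hx h 2) (Real.rpow_nonneg hy (q - 2))
    linarith [key y hy, Real.rpow_nonneg hx q]
  · have h1 := mul_le_mul_of_nonneg_left (Real.rpow_le_rpow hy h (by linarith : 0 ≤ q - 2))
      (sq_nonneg x)
    linarith [key x hx, Real.rpow_nonneg hy q]

/-- The Hardy–Littlewood–Paley inequality for `q ≥ 2`. -/
lemma exists_integral_rpow_le (hd : 1 ≤ d) {q : ℝ} (hq : 2 ≤ q) :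
    ∃ C : ℝ, 0 < C ∧ ∀ (M : ℕ) (c : (Fin d → ℤ) → ℝ),
      ∫ x, ‖partialSum (box d M) c x‖ ^ q ∂cubeMeasure d
        ≤ C * ∑ n ∈ box d M, |c n| ^ q * weight n ^ (d * (q - 2)) := by
  obtain ⟨C, hC, h⟩ := sum_rpow_sum_box_le hd hq
  refine ⟨2 ^ q * (1 + C), by positivity, fun M c => ?_⟩
  have hw : ∀ m : Fin d → ℤ, 0 < weight m := weight_pos
  have hq0 : q ≠ 0 := by linarith
  refine (integral_rpow_partialSum_le hq M c).trans ?_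
  rw [mul_assoc]
  refine mul_le_mul_of_nonneg_left ?_ (by positivity)
  have hpt : ∀ n, c n ^ 2 * (∑ m ∈ box d (supNorm n), |c m|) ^ (q - 2)
      ≤ |c n| ^ q * weight n ^ (d * (q - 2))
        + (∑ m ∈ box d (supNorm n), |c m|) ^ q * weight n ^ (-2 * (d : ℝ)) := by
    intro n
    set B := ∑ m ∈ box d (supNorm n), |c m| with hB
    have hB0 : 0 ≤ B := Finset.sum_nonneg fun _ _ => abs_nonneg _
    have hy := sq_mul_rpow_le (x := |c n| * weight n ^ (d * (q - 2) / q))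
      (y := B * weight n ^ (-2 * (d : ℝ) / q))
      (mul_nonneg (abs_nonneg _) (Real.rpow_nonneg (hw n).le _))
      (mul_nonneg hB0 (Real.rpow_nonneg (hw n).le _)) hq
    rw [mul_pow, sq_abs, Real.mul_rpow hB0 (Real.rpow_nonneg (hw n).le _),
      Real.mul_rpow hB0 (Real.rpow_nonneg (hw n).le _),
      Real.mul_rpow (abs_nonneg _) (Real.rpow_nonneg (hw n).le _),
      ← Real.rpow_mul (hw n).le, ← Real.rpow_mul (hw n).le, ← Real.rpow_mul (hw n).le,
      ← Real.rpow_mul_natCast (hw n).le, div_mul_cancel₀ _ hq0, div_mul_cancel₀ _ hq0] at hy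
    have hone : weight n ^ (d * (q - 2) / q * ((2 : ℕ) : ℝ))
        * weight n ^ (-2 * (d : ℝ) / q * (q - 2)) = 1 := by
      rw [← Real.rpow_add (hw n)]
      have : d * (q - 2) / q * ((2 : ℕ) : ℝ) + -2 * (d : ℝ) / q * (q - 2) = 0 := by
        push_cast
        ring
      rw [this, Real.rpow_zero]
    calc _ = c n ^ 2 * B ^ (q - 2) * (weight n ^ (d * (q - 2) / q * ((2 : ℕ) : ℝ))
        * weight n ^ (-2 * (d : ℝ) / q * (q - 2))) := by rw [hone, mul_one]
      _ ≤ _ := le_trans (le_of_eq (by ring)) hy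
  calc _ ≤ _ := Finset.sum_le_sum fun n _ => hpt n
    _ ≤ _ := by
      rw [Finset.sum_add_distrib]
      linarith [h M c]

lemma eLpNorm_count_eq {α : Type*} [MeasurableSpace α] [MeasurableSingletonClass α]
    {p : ℝ≥0∞} (hp0 : p ≠ 0) (hp : p ≠ ⊤) {s : Finset α} {h : α → ℝ} (hs : ∀ n ∉ s, h n = 0) :
    eLpNorm h p Measure.count
      = ENNReal.ofReal ((∑ n ∈ s, |h n| ^ p.toReal) ^ (1 / p).toReal) := by
  have hpos : 0 < p.toReal := ENNReal.toReal_pos hp0 hp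
  have h1 : (1 / p).toReal = 1 / p.toReal := by simp
  rw [eLpNorm_eq_lintegral_rpow_enorm_toReal hp0 hp, lintegral_count,
    tsum_eq_sum (s := s) fun n hn => by simp [hs n hn, hpos], h1,
    ← ENNReal.ofReal_rpow_of_nonneg (Finset.sum_nonneg fun n _ => by positivity) (by positivity),
    ENNReal.ofReal_sum_of_nonneg fun n _ => by positivity]
  congr 1
  refine Finset.sum_congr rfl fun n _ => ?_
  rw [← ENNReal.ofReal_rpow_of_nonneg (abs_nonneg _) hpos.le, Real.enorm_eq_ofReal_abs]

lemma toReal_one_div_lt {p q : ℝ≥0∞} (hq : 1 ≤ q) (hqp : q < p) :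
    (1 / p).toReal < (1 / q).toReal := by
  have hq0 : q ≠ 0 := (zero_lt_one.trans_le hq).ne'
  refine (ENNReal.toReal_lt_toReal ?_ ?_).mpr ?_
  · simpa using (hq0.bot_lt.trans hqp).ne'
  · simpa using hq0
  · simpa using hqp

/-- The Hardy–Littlewood–Paley inequality combined with Hölder's inequality. -/
lemma exists_trigConst_le (hd : 1 ≤ d) {γ : ℝ} (hγ : 0 ≤ γ) {p q : ℝ≥0∞} (hq : 2 ≤ q)
    (hqp : q < p) :
    ∃ C : ℝ, 0 < C ∧ ∀ M : ℕ, trigConst d γ q p M ≤ ENNReal.ofReal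
      (C * (∑ n ∈ box d M, weight n ^ ((d * (1 - 2 * (1 / q).toReal) - γ) /
        ((1 / q).toReal - (1 / p).toReal))) ^ ((1 / q).toReal - (1 / p).toReal)) := by
  have hq1 : 1 ≤ q := le_trans (by norm_num) hq
  have hq0 : q ≠ 0 := (zero_lt_one.trans_le hq1).ne'
  have hp0 : p ≠ 0 := (hq0.bot_lt.trans hqp).ne'
  have hqt : q ≠ ⊤ := hqp.ne_top
  have hr : 2 ≤ q.toReal := by
    simpa using (ENNReal.toReal_le_toReal (by simp) hqt).mpr hq
  have hr0 : 0 < q.toReal := by linarith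
  have hρ : 0 < (1 / q).toReal - (1 / p).toReal := sub_pos.mpr (toReal_one_div_lt hq1 hqp)
  set ρ := (1 / q).toReal - (1 / p).toReal with hρdef
  have hQ : (1 / q).toReal = q.toReal⁻¹ := by simp
  set κ : ℝ := d * (1 - 2 * (1 / q).toReal) - γ with hκ
  obtain ⟨C, hC, h⟩ := exists_integral_rpow_le hd hr
  refine ⟨C ^ q.toReal⁻¹, by positivity, fun M => iSup_le fun ⟨c, _, _, hcM⟩ => ?_⟩
  refine ENNReal.div_le_of_le_mul ?_
  have hw : ∀ m : Fin d → ℤ, 0 < weight m := weight_pos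
  have hbox : ∀ n, n ∉ box d M → c n = 0 := fun n hn =>
    hcM n (not_le.mp fun hle => hn (mem_box_of_zNorm_le hle))
  set v : (Fin d → ℤ) → ℝ := fun n => if n ∈ box d M then weight n ^ κ else 0 with hv
  set H := ∑ n ∈ box d M, |c n| ^ q.toReal * weight n ^ (d * (q.toReal - 2)) with hH
  have hH0 : 0 ≤ H := Finset.sum_nonneg fun n _ =>
    mul_nonneg (Real.rpow_nonneg (abs_nonneg _) _) (Real.rpow_nonneg (hw n).le _)
  set u : (Fin d → ℤ) → ℝ := fun n => c n * weight n ^ γ with hu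
  have hnum : eLpNorm (trigPoly c) q (cubeMeasure d)
      ≤ ENNReal.ofReal (C ^ q.toReal⁻¹) * eLpNorm (u • v) q Measure.count := by
    rw [trigPoly_eq_partialSum (s := box d M) fun n hn => not_not.mp fun h => hn (hbox n h),
      eLpNorm_eq_integral (by fun_prop) hq0 hqt,
      eLpNorm_count_eq hq0 hqt (s := box d M) (fun n hn => by simp [hu, hbox n hn]),
      ← ENNReal.ofReal_mul (by positivity), hQ]
    refine ENNReal.ofReal_le_ofReal ?_
    have hHe : ∑ n ∈ box d M, |(u • v) n| ^ q.toReal = H := by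
      refine Finset.sum_congr rfl fun n hn => ?_
      have hκr : (γ + κ) * q.toReal = d * (q.toReal - 2) := by
        rw [hκ, hQ]
        field_simp
        ring
      rw [Pi.smul_apply', smul_eq_mul, hv]
      simp only [hu, if_pos hn]
      rw [mul_assoc, ← Real.rpow_add (hw n), abs_mul, abs_of_pos (Real.rpow_pos_of_pos (hw n) _),
        Real.mul_rpow (abs_nonneg _) (Real.rpow_nonneg (hw n).le _), ← Real.rpow_mul (hw n).le,
        hκr]
    rw [hHe, ← Real.mul_rpow hC.le hH0]
    exact Real.rpow_le_rpow (integral_nonneg fun x => by positivity) (h M c) (by positivity)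
  have hs0 : ENNReal.ofReal ρ⁻¹ ≠ 0 := by simpa using hρ
  have : p.HolderTriple (ENNReal.ofReal ρ⁻¹) q := by
    constructor
    have e1 : p⁻¹ = ENNReal.ofReal (1 / p).toReal := by
      rw [ENNReal.ofReal_toReal (by simpa using hp0), one_div]
    have e2 : q⁻¹ = ENNReal.ofReal (1 / q).toReal := by
      rw [ENNReal.ofReal_toReal (by simpa using hq0), one_div]
    rw [← ENNReal.ofReal_inv_of_pos (by positivity), inv_inv, e1, e2,
      ← ENNReal.ofReal_add ENNReal.toReal_nonneg hρ.le, hρdef]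
    congr 1
    ring
  have hhol : eLpNorm (u • v) q Measure.count
      ≤ eLpNorm u p Measure.count * eLpNorm v (ENNReal.ofReal ρ⁻¹) Measure.count :=
    eLpNorm_smul_le_mul_eLpNorm (Measurable.of_discrete.aestronglyMeasurable)
      (Measurable.of_discrete.aestronglyMeasurable)
  have hv' : eLpNorm v (ENNReal.ofReal ρ⁻¹) Measure.count
      = ENNReal.ofReal ((∑ n ∈ box d M, weight n ^ (κ / ρ)) ^ ρ) := by
    rw [eLpNorm_count_eq hs0 ENNReal.ofReal_ne_top (s := box d M)
      (fun n hn => by simp [hv, hn])]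
    have e1 : (ENNReal.ofReal ρ⁻¹).toReal = ρ⁻¹ := ENNReal.toReal_ofReal (by positivity)
    have e2 : (1 / ENNReal.ofReal ρ⁻¹).toReal = ρ := by
      rw [one_div, ENNReal.toReal_inv, e1, inv_inv]
    rw [e1, e2]
    congr 2
    refine Finset.sum_congr rfl fun n hn => ?_
    simp only [hv, if_pos hn]
    rw [abs_of_pos (Real.rpow_pos_of_pos (hw n) _), ← Real.rpow_mul (hw n).le, div_eq_mul_inv]
  have hu' : eLpNorm u p Measure.count
      ≤ eLpNorm (fun n => c n * (1 + zNorm n) ^ γ) p Measure.count := by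
    refine eLpNorm_mono fun n => ?_
    have h1 := Real.rpow_le_rpow (hw n).le (weight_le n) hγ
    have h2 := Real.rpow_nonneg (hw n).le γ
    rw [hu, norm_mul, norm_mul, Real.norm_of_nonneg h2, Real.norm_of_nonneg (h2.trans h1)]
    exact mul_le_mul_of_nonneg_left h1 (norm_nonneg _)
  calc _ ≤ _ := hnum
    _ ≤ ENNReal.ofReal (C ^ q.toReal⁻¹) *
          (eLpNorm (fun n => c n * (1 + zNorm n) ^ γ) p Measure.count
            * ENNReal.ofReal ((∑ n ∈ box d M, weight n ^ (κ / ρ)) ^ ρ)) := by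
        refine mul_le_mul_right (hhol.trans ?_) _
        rw [hv']
        exact mul_le_mul_left hu' _
    _ = _ := by
        rw [ENNReal.ofReal_mul (by positivity)]
        ring

lemma trigConst_le_of_lt (hd : 1 ≤ d) {γ : ℝ} (hγ : 0 ≤ γ) {p q : ℝ≥0∞} (hq : 2 ≤ q)
    (hqp : q < p) (hlt : γ < d * (1 - (1 / p).toReal - (1 / q).toReal)) :
    ∃ C : ℝ, 0 < C ∧ ∀ M : ℕ, 1 ≤ M → trigConst d γ q p M ≤ ENNReal.ofReal
      (C * (M : ℝ) ^ (-γ + d * (1 - (1 / p).toReal - (1 / q).toReal))) := by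
  obtain ⟨C₁, hC₁, h₁⟩ := exists_trigConst_le hd hγ hq hqp
  have hρ : 0 < (1 / q).toReal - (1 / p).toReal :=
    sub_pos.mpr (toReal_one_div_lt (le_trans (by norm_num) hq) hqp)
  set ρ := (1 / q).toReal - (1 / p).toReal with hρdef
  set κ : ℝ := d * (1 - 2 * (1 / q).toReal) - γ with hκ
  set β : ℝ := -γ + d * (1 - (1 / p).toReal - (1 / q).toReal) with hβ
  have hβ0 : 0 < β := by linarith
  have hexp : (d : ℝ) + κ / ρ = β / ρ := by
    field_simp
    rw [hκ, hβ, hρdef]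
    ring
  obtain ⟨C₂, hC₂, h₂⟩ := exists_sum_box_le hd (a := κ / ρ) (by rw [hexp]; positivity)
  refine ⟨C₁ * (C₂ ^ ρ * 2 ^ β), by positivity, fun M hM => (h₁ M).trans ?_⟩
  refine ENNReal.ofReal_le_ofReal ?_
  rw [mul_assoc]
  refine mul_le_mul_of_nonneg_left ?_ hC₁.le
  have hM' : (1 : ℝ) ≤ M := by exact_mod_cast hM
  have hM1 : (0 : ℝ) ≤ (M : ℝ) + 1 := by positivity
  calc _ ≤ (C₂ * ((M : ℝ) + 1) ^ (d + κ / ρ)) ^ ρ :=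
        Real.rpow_le_rpow (Finset.sum_nonneg fun n _ => Real.rpow_nonneg (weight_pos n).le _)
          (h₂ M) hρ.le
    _ = C₂ ^ ρ * ((M : ℝ) + 1) ^ β := by
        rw [Real.mul_rpow hC₂.le (by positivity), ← Real.rpow_mul hM1, hexp,
          div_mul_cancel₀ _ hρ.ne']
    _ ≤ C₂ ^ ρ * (2 * (M : ℝ)) ^ β := by
        refine mul_le_mul_of_nonneg_left ?_ (by positivity)
        exact Real.rpow_le_rpow hM1 (by linarith) hβ0.le
    _ = _ := by
        rw [Real.mul_rpow (by norm_num) (by positivity)]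
        ring

lemma trigConst_le_of_eq (hd : 1 ≤ d) {γ : ℝ} (hγ : 0 ≤ γ) {p q : ℝ≥0∞} (hq : 2 ≤ q)
    (hqp : q < p) (heq : γ = d * (1 - (1 / p).toReal - (1 / q).toReal)) :
    ∃ C : ℝ, 0 < C ∧ ∀ M : ℕ, 1 ≤ M → trigConst d γ q p M ≤ ENNReal.ofReal
      (C * Real.log ((M : ℝ) + 1) ^ ((1 / q).toReal - (1 / p).toReal)) := by
  obtain ⟨C₁, hC₁, h₁⟩ := exists_trigConst_le hd hγ hq hqp
  have hρ : 0 < (1 / q).toReal - (1 / p).toReal :=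
    sub_pos.mpr (toReal_one_div_lt (le_trans (by norm_num) hq) hqp)
  set ρ := (1 / q).toReal - (1 / p).toReal with hρdef
  have hexp : (d * (1 - 2 * (1 / q).toReal) - γ) / ρ = -(d : ℝ) := by
    field_simp
    rw [heq, hρdef]
    ring
  rw [hexp] at h₁
  obtain ⟨C₂, hC₂, h₂⟩ := exists_sum_box_le_log hd
  refine ⟨C₁ * C₂ ^ ρ, by positivity, fun M hM => (h₁ M).trans ?_⟩
  refine ENNReal.ofReal_le_ofReal ?_
  have hlog : 0 ≤ Real.log ((M : ℝ) + 1) := by linarith [half_le_log hM]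
  rw [mul_assoc, ← Real.mul_rpow hC₂.le hlog]
  exact mul_le_mul_of_nonneg_left (Real.rpow_le_rpow
    (Finset.sum_nonneg fun n _ => Real.rpow_nonneg (weight_pos n).le _) (h₂ M hM) hρ.le) hC₁.le

lemma trigConst_le_of_gt (hd : 1 ≤ d) {γ : ℝ} (hγ : 0 ≤ γ) {p q : ℝ≥0∞} (hq : 2 ≤ q)
    (hqp : q < p) (hgt : d * (1 - (1 / p).toReal - (1 / q).toReal) < γ) :
    ∃ C : ℝ, 0 < C ∧ ∀ M : ℕ, trigConst d γ q p M ≤ ENNReal.ofReal (C * 1) := by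
  obtain ⟨C₁, hC₁, h₁⟩ := exists_trigConst_le hd hγ hq hqp
  have hρ : 0 < (1 / q).toReal - (1 / p).toReal :=
    sub_pos.mpr (toReal_one_div_lt (le_trans (by norm_num) hq) hqp)
  set ρ := (1 / q).toReal - (1 / p).toReal with hρdef
  have hexp : (d : ℝ) + (d * (1 - 2 * (1 / q).toReal) - γ) / ρ
      = (d * (1 - (1 / p).toReal - (1 / q).toReal) - γ) / ρ := by
    field_simp
    rw [hρdef]
    ring
  obtain ⟨C₂, hC₂, h₂⟩ := exists_sum_box_tail_le hd
    (a := (d * (1 - 2 * (1 / q).toReal) - γ) / ρ)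
    (by rw [hexp]; exact div_neg_of_neg_of_pos (by linarith) hρ)
  refine ⟨C₁ * C₂ ^ ρ, by positivity, fun M => (h₁ M).trans (ENNReal.ofReal_le_ofReal ?_)⟩
  have h0 := h₂ 0 M
  simp only [zero_le, Finset.filter_true, Nat.cast_zero, zero_add, Real.one_rpow, mul_one] at h0
  rw [mul_one]
  exact mul_le_mul_of_nonneg_left (Real.rpow_le_rpow
    (Finset.sum_nonneg fun n _ => Real.rpow_nonneg (weight_pos n).le _) h0 hρ.le) hC₁.le

/-- The lattice points of `[0, N)^d`. -/
noncomputable def cubePoints (d N : ℕ) : Finset (Fin d → ℤ) :=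
  Fintype.piFinset fun _ => Finset.Ico (0 : ℤ) N

lemma card_cubePoints (d N : ℕ) : (cubePoints d N).card = N ^ d := by
  rw [cubePoints, Fintype.card_piFinset_const, Int.card_Ico]
  simp

lemma mem_cubePoints {N : ℕ} {n : Fin d → ℤ} :
    n ∈ cubePoints d N ↔ ∀ i, 0 ≤ n i ∧ n i < N := by
  simp [cubePoints]

/-- The coefficients of the `d`-dimensional Fejér kernel. -/
noncomputable def fejerCoeff (N : ℕ) (n : Fin d → ℤ) : ℝ :=
  (((cubePoints d N ×ˢ cubePoints d N).filter fun ab => ab.1 - ab.2 = n).card : ℝ) / (N : ℝ) ^ d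

/-- The `d`-dimensional Fejér kernel. -/
noncomputable def fejer (N : ℕ) (x : Fin d → ℝ) : ℝ :=
  ‖partialSum (cubePoints d N) (fun _ => 1) x‖ ^ 2 / (N : ℝ) ^ d

lemma fejerCoeff_nonneg (N : ℕ) (n : Fin d → ℤ) : 0 ≤ fejerCoeff N n := by
  unfold fejerCoeff
  positivity

lemma fejerCoeff_le_one (N : ℕ) (n : Fin d → ℤ) : fejerCoeff N n ≤ 1 := by
  refine div_le_one_of_le₀ ?_ (by positivity)
  have : ((cubePoints d N ×ˢ cubePoints d N).filter fun ab => ab.1 - ab.2 = n).card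
      ≤ (cubePoints d N).card := by
    refine Finset.card_le_card_of_injOn Prod.fst
      (fun ab h => (Finset.mem_product.mp (Finset.mem_filter.mp h).1).1) fun ab h ab' h' he => ?_
    have h1 := (Finset.mem_filter.mp h).2
    have h2 := (Finset.mem_filter.mp h').2
    refine Prod.ext he ?_
    rw [← sub_sub_cancel ab.1 ab.2, ← sub_sub_cancel ab'.1 ab'.2, h1, h2, he]
  rw [card_cubePoints] at this
  exact_mod_cast this

lemma sub_mem_box {K N : ℕ} (hN : N ≤ K + 1) {a b : Fin d → ℤ} (ha : a ∈ cubePoints d N)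
    (hb : b ∈ cubePoints d N) : a - b ∈ box d K := by
  rw [mem_cubePoints] at ha hb
  rw [mem_box, supNorm, Finset.sup_le_iff]
  intro i _
  have := ha i
  have := hb i
  rw [Pi.sub_apply]
  omega

lemma supNorm_lt_of_fejerCoeff_ne_zero {N : ℕ} (hN : 1 ≤ N) {n : Fin d → ℤ}
    (h : fejerCoeff N n ≠ 0) : supNorm n < N := by
  have hne : ((cubePoints d N ×ˢ cubePoints d N).filter fun ab => ab.1 - ab.2 = n).card ≠ 0 :=
    fun h0 => h (by simp [fejerCoeff, h0])
  obtain ⟨ab, hab⟩ := Finset.card_ne_zero.mp hne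
  obtain ⟨hab, hn⟩ := Finset.mem_filter.mp hab
  obtain ⟨ha, hb⟩ := Finset.mem_product.mp hab
  have := mem_box.mp (sub_mem_box (K := N - 1) (by omega) ha hb)
  rw [hn] at this
  omega

lemma partialSum_fejerCoeff {K N : ℕ} (hN : N ≤ K + 1) (x : Fin d → ℝ) :
    partialSum (box d K) (fejerCoeff N) x = (fejer N x : ℂ) := by
  have h1 : ∑ n ∈ box d K,
      (((cubePoints d N ×ˢ cubePoints d N).filter fun ab => ab.1 - ab.2 = n).card : ℂ) * char n x
      = ((‖partialSum (cubePoints d N) (fun _ => 1) x‖ ^ 2 : ℝ) : ℂ) := by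
    have hmaps : ∀ ab ∈ cubePoints d N ×ˢ cubePoints d N, ab.1 - ab.2 ∈ box d K := fun ab h =>
      sub_mem_box hN (Finset.mem_product.mp h).1 (Finset.mem_product.mp h).2
    have hs : star (partialSum (cubePoints d N) (fun _ => 1) x)
        = ∑ m ∈ cubePoints d N, star (char m x) := by
      simp [partialSum]
    push_cast
    rw [← Complex.mul_conj', ← Complex.star_def, hs, partialSum, Finset.sum_mul_sum,
      ← Finset.sum_product', ← Finset.sum_fiberwise_of_maps_to hmaps]
    refine Finset.sum_congr rfl fun n _ => ?_
    rw [← nsmul_eq_mul, ← Finset.sum_const]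
    refine Finset.sum_congr rfl fun ab hab => ?_
    rw [← (Finset.mem_filter.mp hab).2, char_sub]
    simp
  rw [fejer, Complex.ofReal_div, ← h1, partialSum, Finset.sum_div]
  refine Finset.sum_congr rfl fun n _ => ?_
  rw [fejerCoeff]
  push_cast
  ring

lemma fejer_nonneg (N : ℕ) (x : Fin d → ℝ) : 0 ≤ fejer N x := by
  unfold fejer
  positivity

@[fun_prop]
lemma continuous_fejer (N : ℕ) : Continuous (fejer N : (Fin d → ℝ) → ℝ) := by
  unfold fejer
  fun_prop

lemma le_fejer (hd : 1 ≤ d) {N : ℕ} (hN : 1 ≤ N) {x : Fin d → ℝ}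
    (hx : ∀ i, 0 ≤ x i ∧ x i ≤ 1 / (6 * d * N)) : (N : ℝ) ^ d / 4 ≤ fejer N x := by
  have hN0 : (0 : ℝ) < N := by exact_mod_cast hN
  have hd0 : (0 : ℝ) < d := by exact_mod_cast hd
  have hcos : ∀ n ∈ cubePoints d N, 1 / 2 ≤ (char n x).re := by
    intro n hn
    rw [mem_cubePoints] at hn
    have hn' : ∀ i, (0 : ℝ) ≤ n i ∧ (n i : ℝ) ≤ N := fun i =>
      ⟨by exact_mod_cast (hn i).1, by exact_mod_cast (hn i).2.le⟩
    have h0 : 0 ≤ ∑ i, x i * n i := Finset.sum_nonneg fun i _ => mul_nonneg (hx i).1 (hn' i).1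
    have h1 : ∑ i, x i * n i ≤ 1 / 6 := by
      calc ∑ i, x i * n i ≤ ∑ _i : Fin d, 1 / (6 * d * N) * (N : ℝ) :=
            Finset.sum_le_sum fun i _ =>
              mul_le_mul (hx i).2 (hn' i).2 (hn' i).1 (by positivity)
        _ = 1 / 6 := by
            rw [Finset.sum_const, Finset.card_univ, Fintype.card_fin, nsmul_eq_mul]
            field_simp
    rw [char_re, ← Real.cos_pi_div_three]
    refine Real.cos_le_cos_of_nonneg_of_le_pi (by positivity) (by linarith [Real.pi_pos]) ?_
    nlinarith [Real.pi_pos]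
  have hre : (N : ℝ) ^ d / 2 ≤ ‖partialSum (cubePoints d N) (fun _ => 1) x‖ := by
    refine le_trans ?_ (Complex.re_le_norm _)
    calc (N : ℝ) ^ d / 2 = ∑ _n ∈ cubePoints d N, (1 / 2 : ℝ) := by
          rw [Finset.sum_const, card_cubePoints, nsmul_eq_mul]
          push_cast
          ring
      _ ≤ ∑ n ∈ cubePoints d N, (char n x).re := Finset.sum_le_sum hcos
      _ = _ := by simp [partialSum]
  rw [fejer, le_div_iff₀ (by positivity)]
  calc _ = ((N : ℝ) ^ d / 2) ^ 2 := by ring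
    _ ≤ _ := pow_le_pow_left₀ (by positivity) hre 2

/-- The constant in the lower bound for the `L^q` norm of Fejér kernels. -/
noncomputable def fejerConst (d : ℕ) (q : ℝ) : ℝ := (1 / 4) ^ q * (1 / (6 * d)) ^ d

lemma fejerConst_pos (hd : 1 ≤ d) (q : ℝ) : 0 < fejerConst d q := by
  have hd0 : (0 : ℝ) < d := by exact_mod_cast hd
  unfold fejerConst
  positivity

lemma le_integral_fejer_rpow (hd : 1 ≤ d) {N : ℕ} (hN : 1 ≤ N) {q : ℝ} (hq : 1 ≤ q) :
    fejerConst d q * (N : ℝ) ^ (d * (q - 1)) ≤ ∫ x, fejer (d := d) N x ^ q ∂cubeMeasure d := by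
  have hN0 : (0 : ℝ) < N := by exact_mod_cast hN
  have hd1 : (1 : ℝ) ≤ d := by exact_mod_cast hd
  have hN1 : (1 : ℝ) ≤ N := by exact_mod_cast hN
  have hq0 : 0 ≤ q := by linarith
  set δ : ℝ := 1 / (6 * d * N) with hδ
  have hδ0 : 0 < δ := by positivity
  have hδ1 : δ ≤ 1 := by
    rw [hδ, div_le_one (by positivity)]
    nlinarith
  set S : Set (Fin d → ℝ) := Set.univ.pi fun _ => Set.Icc 0 δ with hS
  have hvol : (cubeMeasure d).real S = δ ^ d := by
    have hsub : S ⊆ Set.univ.pi fun _ => Set.Icc (0 : ℝ) 1 :=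
      Set.pi_mono fun i _ => Set.Icc_subset_Icc_right hδ1
    rw [cubeMeasure, measureReal_restrict_apply (MeasurableSet.univ_pi fun _ => measurableSet_Icc),
      Set.inter_eq_left.mpr hsub, Measure.real, hS, volume_pi_pi]
    simp [hδ0.le]
  have hint : Integrable (fun x => fejer (d := d) N x ^ q) (cubeMeasure d) :=
    integrable_of_continuous ((continuous_fejer N).rpow_const fun x => Or.inr hq0)
  have hmarkov := mul_meas_ge_le_integral_of_nonneg
    (.of_forall fun x => Real.rpow_nonneg (fejer_nonneg N x) q) hint (((N : ℝ) ^ d / 4) ^ q)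
  refine le_trans ?_ hmarkov
  have hle : δ ^ d ≤ (cubeMeasure d).real {x | ((N : ℝ) ^ d / 4) ^ q ≤ fejer N x ^ q} := by
    rw [← hvol]
    refine measureReal_mono fun x hx => ?_
    exact Real.rpow_le_rpow (by positivity)
      (le_fejer hd hN fun i => Set.mem_Icc.mp (hx i (Set.mem_univ i))) hq0
  refine le_trans (le_of_eq ?_) (mul_le_mul_of_nonneg_left hle (by positivity))
  have e1 : (N : ℝ) ^ (d * (q - 1)) * (N : ℝ) ^ d = ((N : ℝ) ^ d) ^ q := by
    rw [← Real.rpow_natCast, ← Real.rpow_add hN0, ← Real.rpow_mul hN0.le]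
    congr 1
    ring
  rw [div_eq_mul_one_div ((N : ℝ) ^ d) 4, Real.mul_rpow (by positivity) (by norm_num), ← e1,
    fejerConst, hδ]
  have e2 : (1 / (6 * d) : ℝ) ^ d = (N : ℝ) ^ d * (1 / (6 * d * N)) ^ d := by
    rw [← mul_pow]
    congr 1
    field_simp
  rw [e2]
  ring

lemma sum_rpow_le_rpow_sum {ι : Type*} (s : Finset ι) {f : ι → ℝ} (hf : ∀ i, 0 ≤ f i) {q : ℝ}
    (hq : 1 ≤ q) : ∑ i ∈ s, f i ^ q ≤ (∑ i ∈ s, f i) ^ q := by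
  classical
  induction s using Finset.induction_on with
  | empty => simp [Real.zero_rpow (by linarith : q ≠ 0)]
  | insert i s hi ih =>
    rw [Finset.sum_insert hi, Finset.sum_insert hi]
    exact (add_le_add_right ih _).trans
      (Real.add_rpow_le_rpow_add (hf i) (Finset.sum_nonneg fun j _ => hf j) hq)

/-- Lower bound for the `L^q` norm of nonnegative combinations of Fejér kernels. -/
lemma le_integral_sum_fejer (hd : 1 ≤ d) {q : ℝ} (hq : 1 ≤ q) (J : Finset ℕ) {a : ℕ → ℝ}
    (ha : ∀ j, 0 ≤ a j) {N : ℕ → ℕ} (hN : ∀ j, 1 ≤ N j) {K : ℕ} (hK : ∀ j ∈ J, N j ≤ K + 1) :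
    fejerConst d q * ∑ j ∈ J, a j ^ q * (N j : ℝ) ^ (d * (q - 1))
      ≤ ∫ x, ‖partialSum (box d K) (fun n => ∑ j ∈ J, a j * fejerCoeff (N j) n) x‖ ^ q
        ∂cubeMeasure d := by
  have hq0 : 0 ≤ q := by linarith
  have hsum : ∀ x, partialSum (box d K) (fun n => ∑ j ∈ J, a j * fejerCoeff (N j) n) x
      = ((∑ j ∈ J, a j * fejer (N j) x : ℝ) : ℂ) := by
    intro x
    push_cast
    calc _ = ∑ j ∈ J, (a j : ℂ) * partialSum (box d K) (fejerCoeff (N j)) x := by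
          simp only [partialSum, Finset.mul_sum]
          rw [Finset.sum_comm]
          refine Finset.sum_congr rfl fun n _ => ?_
          push_cast
          rw [Finset.sum_mul]
          exact Finset.sum_congr rfl fun j _ => by ring
      _ = _ := Finset.sum_congr rfl fun j hj => by rw [partialSum_fejerCoeff (hK j hj)]
  have hcont : ∀ j, Continuous fun x : Fin d → ℝ => (a j * fejer (N j) x) ^ q := fun j =>
    (continuous_const.mul (continuous_fejer _)).rpow_const fun x => Or.inr hq0
  calc _ ≤ ∑ j ∈ J, ∫ x, (a j * fejer (d := d) (N j) x) ^ q ∂cubeMeasure d := by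
        rw [Finset.mul_sum]
        refine Finset.sum_le_sum fun j _ => ?_
        simp_rw [Real.mul_rpow (ha j) (fejer_nonneg (N j) _)]
        rw [integral_const_mul, mul_left_comm]
        exact mul_le_mul_of_nonneg_left (le_integral_fejer_rpow hd (hN j) hq)
          (Real.rpow_nonneg (ha j) q)
    _ = ∫ x, ∑ j ∈ J, (a j * fejer (d := d) (N j) x) ^ q ∂cubeMeasure d :=
        (integral_finsetSum _ fun j _ => integrable_of_continuous (hcont j)).symm
    _ ≤ _ := by
        refine integral_mono
          (integrable_of_continuous (continuous_finsetSum _ fun j _ => hcont j))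
          (integrable_of_continuous
            ((continuous_partialSum _ _).norm.rpow_const fun x => Or.inr hq0)) fun x => ?_
        have hnn : ∀ j, 0 ≤ a j * fejer (N j) x := fun j => mul_nonneg (ha j) (fejer_nonneg _ _)
        dsimp only
        rw [hsum, Complex.norm_real, Real.norm_of_nonneg (Finset.sum_nonneg fun j _ => hnn j)]
        exact sum_rpow_le_rpow_sum J hnn hq

lemma le_trigConst {γ : ℝ} {p q : ℝ≥0∞} {M : ℕ} {c : (Fin d → ℤ) → ℝ} (hc : c ≠ 0)
    (hM : ∀ n, (M : ℝ) < zNorm n → c n = 0) {A B : ℝ} (hB : 0 < B)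
    (hA' : ENNReal.ofReal A ≤ eLpNorm (trigPoly c) q (cubeMeasure d))
    (hB' : eLpNorm (fun n => c n * (1 + zNorm n) ^ γ) p Measure.count ≤ ENNReal.ofReal B) :
    ENNReal.ofReal (A / B) ≤ trigConst d γ q p M := by
  have hfin : (Function.support c).Finite := (box d M).finite_toSet.subset fun n hn =>
    mem_box_of_zNorm_le (not_lt.mp fun h => hn (hM n h))
  rw [ENNReal.ofReal_div_of_pos hB]
  refine (ENNReal.div_le_div hA' hB').trans ?_
  exact le_iSup (fun c : {c : (Fin d → ℤ) → ℝ // c ≠ 0 ∧ (Function.support c).Finite ∧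
      ∀ n, (M : ℝ) < zNorm n → c n = 0} =>
    eLpNorm (trigPoly c.1) q (cubeMeasure d) /
      eLpNorm (fun n => c.1 n * (1 + zNorm n) ^ γ) p Measure.count) ⟨c, hc, hfin, hM⟩

lemma eLpNorm_count_le {α : Type*} [MeasurableSpace α] [MeasurableSingletonClass α]
    {p : ℝ≥0∞} (hp : p ≠ 0) {h u : α → ℝ} {s : Finset α} (hs : ∀ n ∉ s, h n = 0) {B : ℝ}
    (hB : 0 ≤ B) (hu : ∀ n, 0 ≤ u n) (hle : ∀ n ∈ s, |h n| ≤ B * u n ^ (1 / p).toReal) :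
    eLpNorm h p Measure.count ≤ ENNReal.ofReal (B * (∑ n ∈ s, u n) ^ (1 / p).toReal) := by
  rcases eq_or_ne p ⊤ with rfl | hpt
  · simp only [one_div, ENNReal.inv_top, ENNReal.toReal_zero, Real.rpow_zero, mul_one] at hle ⊢
    have hb : ∀ n, ‖h n‖ ≤ B := fun n => by
      by_cases hn : n ∈ s
      · exact hle n hn
      · simpa [hs n hn] using hB
    simpa using eLpNorm_le_of_ae_bound (p := ⊤) (μ := Measure.count) (.of_forall hb)
  · have hp0 : 0 < p.toReal := ENNReal.toReal_pos hp hpt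
    have hP : (1 / p).toReal = 1 / p.toReal := by simp
    rw [eLpNorm_count_eq hp hpt hs]
    refine ENNReal.ofReal_le_ofReal ?_
    have hle' : ∑ n ∈ s, |h n| ^ p.toReal ≤ B ^ p.toReal * ∑ n ∈ s, u n := by
      rw [Finset.mul_sum]
      refine Finset.sum_le_sum fun n hn => ?_
      calc _ ≤ (B * u n ^ (1 / p).toReal) ^ p.toReal :=
            Real.rpow_le_rpow (abs_nonneg _) (hle n hn) hp0.le
        _ = _ := by
            rw [Real.mul_rpow hB (Real.rpow_nonneg (hu n) _), ← Real.rpow_mul (hu n), hP,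
              one_div_mul_cancel hp0.ne', Real.rpow_one]
    calc _ ≤ (B ^ p.toReal * ∑ n ∈ s, u n) ^ (1 / p).toReal :=
          Real.rpow_le_rpow (Finset.sum_nonneg fun n _ => by positivity) hle' (by positivity)
      _ = _ := by
          rw [Real.mul_rpow (by positivity) (Finset.sum_nonneg fun n _ => hu n),
            ← Real.rpow_mul hB, hP, mul_one_div_cancel hp0.ne', Real.rpow_one]

/-- Testing `trigConst` on a nonnegative combination of Fejér kernels. -/
lemma le_trigConst_of_sum_fejer (hd : 1 ≤ d) {γ : ℝ} {p q : ℝ≥0∞} (hp : p ≠ 0) (hq : 1 ≤ q)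
    (hqt : q ≠ ⊤) (J : Finset ℕ) {a : ℕ → ℝ} (ha : ∀ j, 0 ≤ a j) {N : ℕ → ℕ}
    (hN : ∀ j, 1 ≤ N j) {K M : ℕ} (hK : ∀ j ∈ J, N j ≤ K + 1) (hM : d * K ≤ M)
    {S : ℝ} (hS : 0 < S)
    (hS' : S ≤ ∑ j ∈ J, a j ^ q.toReal * (N j : ℝ) ^ (d * (q.toReal - 1)))
    {B : ℝ} (hB : 0 < B) {u : (Fin d → ℤ) → ℝ} (hu : ∀ n, 0 < u n)
    (hle : ∀ n, (∑ j ∈ J, a j * fejerCoeff (N j) n) * (1 + zNorm n) ^ γ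
      ≤ B * u n ^ (1 / p).toReal) :
    ENNReal.ofReal ((fejerConst d q.toReal * S) ^ (1 / q).toReal
      / (B * (∑ n ∈ box d K, u n) ^ (1 / p).toReal)) ≤ trigConst d γ q p M := by
  have hq0 : q ≠ 0 := (one_pos.trans_le hq).ne'
  have hqr : 1 ≤ q.toReal := by simpa using ENNReal.toReal_mono hqt hq
  set c : (Fin d → ℤ) → ℝ := fun n => ∑ j ∈ J, a j * fejerCoeff (N j) n with hc
  have hint := le_integral_sum_fejer hd hqr J ha hN hK
  have hnum : 0 < fejerConst d q.toReal * S := mul_pos (fejerConst_pos hd _) hS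
  have hint' := (mul_le_mul_of_nonneg_left hS' (fejerConst_pos hd _).le).trans hint
  have hsupp : ∀ n ∉ box d K, c n = 0 := fun n hn => Finset.sum_eq_zero fun j hj => by
    rw [mem_box] at hn
    have := hK j hj
    by_contra h
    have := supNorm_lt_of_fejerCoeff_ne_zero (hN j) (right_ne_zero_of_mul h)
    omega
  have hc0 : c ≠ 0 := by
    intro h0
    refine absurd (hnum.trans_le hint') ?_
    rw [← hc, h0]
    simp [partialSum, Real.zero_rpow (by linarith : q.toReal ≠ 0)]
  have hbox : 0 < ∑ n ∈ box d K, u n :=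
    Finset.sum_pos (fun n _ => hu n) ⟨0, mem_box.mpr (by simp [supNorm])⟩
  refine le_trigConst hc0 (fun n hn => hsupp n fun hn' => ?_) (by positivity) ?_
    (eLpNorm_count_le hp (s := box d K) (fun n hn => by rw [hsupp n hn, zero_mul]) hB.le
      (fun n => (hu n).le) fun n _ => ?_)
  · have h1 : d * supNorm n ≤ M := (Nat.mul_le_mul_left d (mem_box.mp hn')).trans hM
    have h2 := zNorm_le n
    have h3 : (d * supNorm n : ℝ) ≤ M := by exact_mod_cast h1
    linarith
  · rw [trigPoly_eq_partialSum fun n hn => not_imp_comm.mp (hsupp n) hn,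
      eLpNorm_eq_integral (continuous_partialSum _ _) hq0 hqt]
    refine ENNReal.ofReal_le_ofReal ?_
    rw [one_div, ENNReal.toReal_inv]
    exact Real.rpow_le_rpow hnum.le hint' (by positivity)
  · have hz : 0 ≤ zNorm n := Real.sqrt_nonneg _
    rw [abs_of_nonneg]
    · exact hle n
    · exact mul_nonneg (Finset.sum_nonneg fun j _ => mul_nonneg (ha j) (fejerCoeff_nonneg _ _))
        (by positivity)

lemma one_add_zNorm_rpow_le (hd : 1 ≤ d) {γ : ℝ} (hγ : 0 ≤ γ) (n : Fin d → ℤ) :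
    (1 + zNorm n) ^ γ ≤ (d : ℝ) ^ γ * weight n ^ γ := by
  have hz : 0 ≤ zNorm n := Real.sqrt_nonneg _
  rw [← Real.mul_rpow (by positivity) (weight_pos n).le]
  exact Real.rpow_le_rpow (by positivity) (one_add_zNorm_le hd n) hγ

lemma exists_le_trigConst (hd : 1 ≤ d) {γ : ℝ} (hγ : 0 ≤ γ) {p q : ℝ≥0∞} (hp : p ≠ 0)
    (hq : 1 ≤ q) (hqt : q ≠ ⊤) :
    ∃ c : ℝ, 0 < c ∧ ∀ N M : ℕ, 1 ≤ N → d * (N - 1) ≤ M →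
      ENNReal.ofReal (c * (N : ℝ) ^ (-γ + d * (1 - (1 / p).toReal - (1 / q).toReal)))
        ≤ trigConst d γ q p M := by
  have hd0 : (0 : ℝ) < d := by exact_mod_cast hd
  have hc := fejerConst_pos hd q.toReal
  have hqr : 1 ≤ q.toReal := by simpa using ENNReal.toReal_mono hqt hq
  have hQ : q.toReal * (1 / q).toReal = 1 := by
    rw [one_div, ENNReal.toReal_inv, mul_inv_cancel₀ (by linarith)]
  refine ⟨fejerConst d q.toReal ^ (1 / q).toReal / ((d : ℝ) ^ γ * ((2 : ℝ) ^ d) ^ (1 / p).toReal),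
    by positivity, fun N M hN hM => ?_⟩
  have hN0 : (0 : ℝ) < N := by exact_mod_cast hN
  have key := le_trigConst_of_sum_fejer hd (γ := γ) hp hq hqt {0} (a := fun _ => 1)
    (fun _ => zero_le_one) (N := fun _ => N) (fun _ => hN) (K := N - 1) (M := M)
    (fun _ _ => by omega) hM (S := (N : ℝ) ^ (d * (q.toReal - 1))) (by positivity) (by simp)
    (B := (d : ℝ) ^ γ * (N : ℝ) ^ γ) (by positivity) (u := fun _ => 1) (fun _ => one_pos)
    fun n => ?_
  · refine le_trans (ENNReal.ofReal_le_ofReal ?_) key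
    have hcard : ∑ _n ∈ box d (N - 1), (1 : ℝ) ≤ 2 ^ d * (N : ℝ) ^ d := by
      rw [Finset.sum_const, card_box, nsmul_eq_mul, mul_one, ← mul_pow]
      have : (2 * (N - 1) + 1) ^ d ≤ (2 * N) ^ d := Nat.pow_le_pow_left (by omega) d
      exact_mod_cast this
    have hcard0 : 0 < ∑ _n ∈ box d (N - 1), (1 : ℝ) :=
      Finset.sum_pos (fun n _ => one_pos) ⟨0, mem_box.mpr (by simp [supNorm])⟩
    have e : (N : ℝ) ^ (-γ + d * (1 - (1 / p).toReal - (1 / q).toReal))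
        = ((N : ℝ) ^ (d * (q.toReal - 1))) ^ (1 / q).toReal
          / ((N : ℝ) ^ γ * ((N : ℝ) ^ d) ^ (1 / p).toReal) := by
      rw [← Real.rpow_natCast, ← Real.rpow_mul hN0.le, ← Real.rpow_mul hN0.le,
        ← Real.rpow_add hN0, ← Real.rpow_sub hN0]
      congr 1
      linear_combination (-d : ℝ) * hQ
    rw [e, Real.mul_rpow hc.le (by positivity), div_mul_div_comm]
    refine div_le_div_of_nonneg_left (by positivity) (by positivity) ?_
    calc _ ≤ (d : ℝ) ^ γ * (N : ℝ) ^ γ * (2 ^ d * (N : ℝ) ^ d) ^ (1 / p).toReal :=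
          mul_le_mul_of_nonneg_left
            (Real.rpow_le_rpow hcard0.le hcard ENNReal.toReal_nonneg) (by positivity)
      _ = _ := by
          rw [Real.mul_rpow (by positivity) (by positivity)]
          ring
  · simp only [Finset.sum_singleton, one_mul, Real.one_rpow, mul_one]
    have hz : 0 ≤ zNorm n := Real.sqrt_nonneg _
    rcases eq_or_ne (fejerCoeff N n) 0 with h | h
    · rw [h, zero_mul]
      positivity
    · have hw : weight n ≤ N := by
        have := supNorm_lt_of_fejerCoeff_ne_zero hN h
        unfold weight
        exact_mod_cast this
      calc _ ≤ 1 * (1 + zNorm n) ^ γ :=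
            mul_le_mul_of_nonneg_right (fejerCoeff_le_one N n) (by positivity)
        _ ≤ (d : ℝ) ^ γ * weight n ^ γ := by
            rw [one_mul]
            exact one_add_zNorm_rpow_le hd hγ n
        _ ≤ _ := mul_le_mul_of_nonneg_left
            (Real.rpow_le_rpow (weight_pos n).le hw hγ) (by positivity)

lemma le_trigConst_of_lt (hd : 1 ≤ d) {γ : ℝ} (hγ : 0 ≤ γ) {p q : ℝ≥0∞} (hp : p ≠ 0)
    (hq : 1 ≤ q) (hqt : q ≠ ⊤) (h : γ < d * (1 - (1 / p).toReal - (1 / q).toReal)) :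
    ∃ c : ℝ, 0 < c ∧ ∀ M : ℕ, 1 ≤ M →
      ENNReal.ofReal (c * (M : ℝ) ^ (-γ + d * (1 - (1 / p).toReal - (1 / q).toReal)))
        ≤ trigConst d γ q p M := by
  obtain ⟨c, hc, key⟩ := exists_le_trigConst hd hγ hp hq hqt
  have hd0 : (0 : ℝ) < d := by exact_mod_cast hd
  set β : ℝ := -γ + d * (1 - (1 / p).toReal - (1 / q).toReal) with hβ
  refine ⟨c / (d : ℝ) ^ β, by positivity, fun M _ => ?_⟩
  refine le_trans (ENNReal.ofReal_le_ofReal ?_)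
    (key (M / d + 1) M (Nat.succ_pos _) (by simpa using Nat.mul_div_le M d))
  have hMd : (M : ℝ) / d ≤ (M / d + 1 : ℕ) := by
    rw [div_le_iff₀ hd0]
    exact_mod_cast ((Nat.lt_mul_div_succ M hd).trans_eq (mul_comm _ _)).le
  calc _ = c * ((M : ℝ) / d) ^ β := by
        rw [Real.div_rpow (by positivity) hd0.le]
        ring
    _ ≤ _ := mul_le_mul_of_nonneg_left
        (Real.rpow_le_rpow (by positivity) hMd (by linarith)) hc.le

lemma le_trigConst_one (hd : 1 ≤ d) {γ : ℝ} (hγ : 0 ≤ γ) {p q : ℝ≥0∞} (hp : p ≠ 0)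
    (hq : 1 ≤ q) (hqt : q ≠ ⊤) :
    ∃ c : ℝ, 0 < c ∧ ∀ M : ℕ, ENNReal.ofReal (c * 1) ≤ trigConst d γ q p M := by
  obtain ⟨c, hc, key⟩ := exists_le_trigConst hd hγ hp hq hqt
  exact ⟨c, hc, fun M => by simpa using key 1 M le_rfl (by simp)⟩

/-- Geometric sums over the dyadic scales above `|n|`. -/
lemma sum_two_pow_rpow_le {κ : ℝ} (hκ : 0 < κ) (L : ℕ) (n : Fin d → ℤ) :
    ∑ j ∈ Finset.range L, ((2 : ℝ) ^ j) ^ (-κ) * fejerCoeff (2 ^ j) n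
      ≤ 1 / (1 - (2 : ℝ) ^ (-κ)) * weight n ^ (-κ) := by
  set r : ℝ := (2 : ℝ) ^ (-κ) with hr
  have hr0 : 0 < r := by positivity
  have hr1 : r < 1 := Real.rpow_lt_one_of_one_lt_of_neg (by norm_num) (by linarith)
  have hrj : ∀ j : ℕ, ((2 : ℝ) ^ j) ^ (-κ) = r ^ j := fun j => by
    rw [hr, ← Real.rpow_natCast, ← Real.rpow_natCast, ← Real.rpow_mul, ← Real.rpow_mul, mul_comm]
      <;> norm_num
  set k := Nat.clog 2 (supNorm n + 1) with hk
  have hkw : weight n ≤ (2 : ℝ) ^ k := by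
    have := Nat.le_pow_clog one_lt_two (supNorm n + 1)
    unfold weight
    exact_mod_cast this
  have hzero : ∀ j, ¬ k ≤ j → fejerCoeff (2 ^ j) n = 0 := fun j hj => by
    by_contra h
    have h1 := supNorm_lt_of_fejerCoeff_ne_zero Nat.one_le_two_pow h
    exact hj (Nat.clog_le_of_le_pow h1)
  calc _ ≤ ∑ j ∈ Finset.range L, if k ≤ j then r ^ j else 0 := by
        refine Finset.sum_le_sum fun j _ => ?_
        rw [hrj]
        split_ifs with h
        · exact mul_le_of_le_one_right (by positivity) (fejerCoeff_le_one _ _)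
        · rw [hzero j h, mul_zero]
    _ = ∑ j ∈ (Finset.range L).filter (fun j => k ≤ j), r ^ j := (Finset.sum_filter _ _).symm
    _ = ∑ j ∈ Finset.Ico k L, r ^ j := by
        refine Finset.sum_congr ?_ fun _ _ => rfl
        ext j
        simp [and_comm]
    _ ≤ r ^ k / (1 - r) := geom_sum_Ico_le_of_lt_one hr0.le hr1
    _ = 1 / (1 - r) * ((2 : ℝ) ^ k) ^ (-κ) := by
        rw [hrj]
        ring
    _ ≤ _ := mul_le_mul_of_nonneg_left
        (Real.rpow_le_rpow_of_nonpos (weight_pos n) hkw (by linarith))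
        (one_div_nonneg.mpr (by linarith))

lemma log_le_mul_log_add_one (hd : 1 ≤ d) (M : ℕ) :
    Real.log ((M : ℝ) + 1) ≤ d * ((Nat.log 2 (M / d + 1) + 1 : ℕ) : ℝ) := by
  have hd0 : (0 : ℝ) < d := by exact_mod_cast hd
  set L := Nat.log 2 (M / d + 1) with hL
  have h1 : (M : ℝ) / d + 1 ≤ (2 : ℝ) ^ (L + 1) := by
    have h2 : M / d + 1 + 1 ≤ 2 ^ (L + 1) := Nat.lt_pow_succ_log_self one_lt_two _
    have h3 : (M : ℝ) / d ≤ (M / d + 1 : ℕ) := by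
      rw [div_le_iff₀ hd0]
      exact_mod_cast ((Nat.lt_mul_div_succ M hd).trans_eq (mul_comm _ _)).le
    have h4 : ((M / d + 1 : ℕ) : ℝ) + 1 ≤ (2 : ℝ) ^ (L + 1) := by exact_mod_cast h2
    linarith
  have h2 : (M : ℝ) + 1 ≤ ((M : ℝ) / d + 1) ^ d := by
    have := one_add_mul_le_pow (a := (M : ℝ) / d)
      (by linarith [show (0 : ℝ) ≤ (M : ℝ) / d by positivity]) d
    rw [mul_div_cancel₀ _ hd0.ne'] at this
    linarith [add_comm (1 : ℝ) ((M : ℝ) / d) ▸ this]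
  calc _ ≤ Real.log (((2 : ℝ) ^ (L + 1)) ^ d) := by
        refine Real.log_le_log (by positivity) (h2.trans ?_)
        exact pow_le_pow_left₀ (by positivity) h1 d
    _ = d * ((L + 1 : ℕ) * Real.log 2) := by rw [Real.log_pow, Real.log_pow]
    _ ≤ _ := by
        have : Real.log 2 ≤ 1 := by linarith [Real.log_two_lt_d9]
        refine mul_le_mul_of_nonneg_left ?_ hd0.le
        exact mul_le_of_le_one_right (by positivity) this

lemma le_trigConst_of_eq (hd : 1 ≤ d) {γ : ℝ} (hγ : 0 ≤ γ) {p q : ℝ≥0∞} (hp : p ≠ 0)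
    (hq : 1 < q) (hqt : q ≠ ⊤) (h : γ = d * (1 - (1 / p).toReal - (1 / q).toReal)) :
    ∃ c : ℝ, 0 < c ∧ ∀ M : ℕ, 1 ≤ M →
      ENNReal.ofReal (c * Real.log ((M : ℝ) + 1) ^ ((1 / q).toReal - (1 / p).toReal))
        ≤ trigConst d γ q p M := by
  obtain ⟨D, hD, hsum⟩ := exists_sum_box_le_log hd
  have hd0 : (0 : ℝ) < d := by exact_mod_cast hd
  have hc := fejerConst_pos hd q.toReal
  have hqr : 1 < q.toReal := by simpa using ENNReal.toReal_strict_mono hqt hq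
  have hQ : (1 / q).toReal * q.toReal = 1 := by
    rw [one_div, ENNReal.toReal_inv, inv_mul_cancel₀ (by linarith)]
  have hQ1 : (1 / q).toReal < 1 := by
    rw [one_div, ENNReal.toReal_inv]
    exact inv_lt_one_of_one_lt₀ hqr
  set P := (1 / p).toReal with hP
  set Q := (1 / q).toReal
  have hP0 : 0 ≤ P := ENNReal.toReal_nonneg
  set κ : ℝ := d * (1 - Q) with hκ
  have hκ0 : 0 < κ := mul_pos hd0 (by linarith)
  have hr1 : (2 : ℝ) ^ (-κ) < 1 := Real.rpow_lt_one_of_one_lt_of_neg (by norm_num) (by linarith)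
  have hB : 0 < 1 / (1 - (2 : ℝ) ^ (-κ)) * (d : ℝ) ^ γ :=
    mul_pos (one_div_pos.mpr (by linarith)) (by positivity)
  set B : ℝ := 1 / (1 - (2 : ℝ) ^ (-κ)) * (d : ℝ) ^ γ with hBdef
  refine ⟨(fejerConst d q.toReal * (1 / d)) ^ Q / (B * D ^ P), by positivity, fun M hM => ?_⟩
  set L := Nat.log 2 (M / d + 1) with hL
  set ℓ := Real.log ((M : ℝ) + 1) with hℓ
  have hℓ0 : 0 < ℓ := by linarith [half_le_log hM]
  have key := le_trigConst_of_sum_fejer hd (γ := γ) hp hq.le hqt (Finset.range (L + 1))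
    (a := fun j => ((2 : ℝ) ^ j) ^ (-κ)) (fun j => by positivity) (N := fun j => 2 ^ j)
    (fun j => Nat.one_le_two_pow) (K := M / d) (M := M) (fun j hj => ?_) (Nat.mul_div_le M d)
    (S := 1 / d * ℓ) (by positivity) ?_ hB (u := fun n => weight n ^ (-(d : ℝ)))
    (fun n => Real.rpow_pos_of_pos (weight_pos n) _) fun n => ?_
  · refine le_trans (ENNReal.ofReal_le_ofReal ?_) key
    have hle : ∑ n ∈ box d (M / d), weight n ^ (-(d : ℝ)) ≤ D * ℓ := by
      refine le_trans (Finset.sum_le_sum_of_subset_of_nonneg (fun n hn => ?_) fun n _ _ =>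
        Real.rpow_nonneg (weight_pos n).le _) (hsum M hM)
      exact mem_box.mpr ((mem_box.mp hn).trans (Nat.div_le_self M d))
    have hpos : 0 < ∑ n ∈ box d (M / d), weight n ^ (-(d : ℝ)) :=
      Finset.sum_pos (fun n _ => Real.rpow_pos_of_pos (weight_pos n) _)
        ⟨0, mem_box.mpr (by simp [supNorm])⟩
    rw [← mul_assoc, Real.mul_rpow (by positivity) hℓ0.le, Real.rpow_sub hℓ0, div_mul_div_comm]
    refine div_le_div_of_nonneg_left (by positivity) (by positivity) ?_
    calc _ ≤ B * (D * ℓ) ^ P :=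
          mul_le_mul_of_nonneg_left (Real.rpow_le_rpow hpos.le hle hP0) hB.le
      _ = _ := by
          rw [Real.mul_rpow hD.le hℓ0.le]
          ring
  · exact (Nat.pow_le_pow_right two_pos (Nat.lt_succ_iff.mp (Finset.mem_range.mp hj))).trans
      (Nat.pow_log_le_self 2 (Nat.succ_ne_zero _))
  · have hone : ∀ j : ℕ, (((2 : ℝ) ^ j) ^ (-κ)) ^ q.toReal
        * ((2 ^ j : ℕ) : ℝ) ^ (d * (q.toReal - 1)) = 1 := fun j => by
      have h2 : (0 : ℝ) < 2 ^ j := by positivity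
      rw [Nat.cast_pow, Nat.cast_ofNat, ← Real.rpow_mul h2.le, ← Real.rpow_add h2]
      rw [show -κ * q.toReal + d * (q.toReal - 1) = 0 by
        rw [hκ]; linear_combination (d : ℝ) * hQ, Real.rpow_zero]
    rw [Finset.sum_congr rfl fun j _ => hone j, Finset.sum_const, Finset.card_range, nsmul_eq_mul,
      mul_one, one_div_mul_eq_div, div_le_iff₀ hd0, mul_comm]
    exact log_le_mul_log_add_one hd M
  · have hw := weight_pos n
    have hz : 0 ≤ zNorm n := Real.sqrt_nonneg _
    calc _ ≤ 1 / (1 - (2 : ℝ) ^ (-κ)) * weight n ^ (-κ) * ((d : ℝ) ^ γ * weight n ^ γ) :=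
          mul_le_mul (sum_two_pow_rpow_le hκ0 _ n) (one_add_zNorm_rpow_le hd hγ n)
            (by positivity)
            (mul_nonneg (one_div_nonneg.mpr (by linarith)) (by positivity))
      _ = B * (weight n ^ (-κ) * weight n ^ γ) := by
          rw [hBdef]
          ring
      _ = _ := by
          rw [← Real.rpow_add hw, ← Real.rpow_mul hw.le]
          congr 2
          rw [h, hκ]
          ring

end TrigConst

/-- Lemma 2.2, items (3) and (4): behaviour of `C_{q,p}(M)` for `2 ≤ q < p ≤ ∞`
and comparison `C_{q,p} ≈ C_{2,p}` for `1 ≤ q < 2`. -/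
theorem trigConst_asymptotics_q_lt_p
    (d : ℕ) (hd : 1 ≤ d) (γ : ℝ) (hγ : 0 ≤ γ) (p q : ℝ≥0∞) (hp : 1 ≤ p) (hq : 1 ≤ q) :
    ∃ c C : ℝ, 0 < c ∧ 0 < C ∧ ∀ M : ℕ, 1 ≤ M →
      ((2 ≤ q ∧ q < p →
          (γ < (d : ℝ) * (1 - (1/p).toReal - (1/q).toReal) →
            Approx (trigConst d γ q p M) c C
              ((M : ℝ) ^ (-γ + (d : ℝ) * (1 - (1/p).toReal - (1/q).toReal)))) ∧
          (γ = (d : ℝ) * (1 - (1/p).toReal - (1/q).toReal) →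
            Approx (trigConst d γ q p M) c C
              (Real.log ((M : ℝ) + 1) ^ ((1/q).toReal - (1/p).toReal))) ∧
          ((d : ℝ) * (1 - (1/p).toReal - (1/q).toReal) < γ →
            Approx (trigConst d γ q p M) c C 1)) ∧
        (q < 2 →
          ENNReal.ofReal c * trigConst d γ 2 p M ≤ trigConst d γ q p M ∧
            trigConst d γ q p M ≤ ENNReal.ofReal C * trigConst d γ 2 p M)) := by
  have hp0 : p ≠ 0 := (one_pos.trans_le hp).ne'
  by_cases hqp : 2 ≤ q ∧ q < p
  · have hqt : q ≠ ⊤ := hqp.2.ne_top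
    rcases lt_trichotomy γ (d * (1 - (1 / p).toReal - (1 / q).toReal)) with h | h | h
    · obtain ⟨c, hc, hlow⟩ := TrigConst.le_trigConst_of_lt hd hγ hp0 hq hqt h
      obtain ⟨C, hC, hup⟩ := TrigConst.trigConst_le_of_lt hd hγ hqp.1 hqp.2 h
      exact ⟨c, C, hc, hC, fun M hM =>
        ⟨fun _ => ⟨fun _ => ⟨hlow M hM, hup M hM⟩, fun h' => absurd h' h.ne,
          fun h' => absurd h' h.not_gt⟩, fun h' => absurd h' hqp.1.not_gt⟩⟩
    · have hq1 : 1 < q := ENNReal.one_lt_two.trans_le hqp.1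
      obtain ⟨c, hc, hlow⟩ := TrigConst.le_trigConst_of_eq hd hγ hp0 hq1 hqt h
      obtain ⟨C, hC, hup⟩ := TrigConst.trigConst_le_of_eq hd hγ hqp.1 hqp.2 h
      exact ⟨c, C, hc, hC, fun M hM =>
        ⟨fun _ => ⟨fun h' => absurd h h'.ne, fun _ => ⟨hlow M hM, hup M hM⟩,
          fun h' => absurd h h'.ne'⟩, fun h' => absurd h' hqp.1.not_gt⟩⟩
    · obtain ⟨c, hc, hlow⟩ := TrigConst.le_trigConst_one hd hγ hp0 hq hqt
      obtain ⟨C, hC, hup⟩ := TrigConst.trigConst_le_of_gt hd hγ hqp.1 hqp.2 h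
      exact ⟨c, C, hc, hC, fun M hM =>
        ⟨fun _ => ⟨fun h' => absurd h' h.not_gt, fun h' => absurd h' h.ne',
          fun _ => ⟨hlow M, hup M⟩⟩, fun h' => absurd h' hqp.1.not_gt⟩⟩
  · refine ⟨1 / 5, 1, by norm_num, one_pos, fun M _ => ⟨fun h => absurd h hqp, fun h => ⟨?_, ?_⟩⟩⟩
    · have h5 : ENNReal.ofReal (1 / 5) = 5⁻¹ := by
        rw [one_div, ENNReal.ofReal_inv_of_pos (by norm_num), ENNReal.ofReal_ofNat]
      rw [h5, ENNReal.inv_mul_le_iff (by norm_num) (by norm_num)]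
      exact TrigConst.trigConst_two_le γ hq p M
    · rw [ENNReal.ofReal_one, one_mul]
      exact TrigConst.trigConst_mono_exponent γ h.le p M
end

section
/- Let d ≥ 1, 1 ≤ p,q ≤ ∞ with q < ∞, and let A = (A₁,A₂), B = (B₁,B₂), D = (D₁,D₂) be pairs with A₁,A₂ ≥ 0, 0 ≤ D₁ ≤ B₁, 0 ≤ D₂ ≤ B₂; set L = B − D (coordinatewise). Let C_{q,p}(t) = sup over nonzero Schwartz f of ( ∫_{|x|≤t} |f|^q )^{1/q} / ‖ ξ^D f̂ ‖_p. Then there is a constant c (depending only on d,p,q,A,B,D) such that for every Schwartz function f on ℝ^d and every t > 0: ‖f‖_q ≤ c ( C_{q,p}(t) · t^{L^T} · ‖ ξ^B f̂ ‖_p + t^{−A} · ‖ x^A f ‖_q ), where t^{L^T} = t^{L₂} for t < 1 and t^{L₁} for t ≥ 1, and t^{−A} = t^{−A₁} for t < 1 and t^{−A₂} for t ≥ 1. -/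
open MeasureTheory
open scoped ENNReal FourierTransform

/-- The broken power weight `x^A`: `|x|^{A₁}` for `|x| < 1`, `|x|^{A₂}` for `|x| ≥ 1`. -/
noncomputable def brokenWeight {d : ℕ} (A : ℝ × ℝ) (x : EuclideanSpace ℝ (Fin d)) : ℝ :=
  if ‖x‖ < 1 then ‖x‖ ^ A.1 else ‖x‖ ^ A.2

/-- Broken power of a positive real number `t`: `t^{E₁}` for `t < 1`, `t^{E₂}` for `t ≥ 1`. -/
noncomputable def brokenPow (E : ℝ × ℝ) (t : ℝ) : ℝ :=
  if t < 1 then t ^ E.1 else t ^ E.2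

/-- The best constant `C_{q,p}(t)` in the local uncertainty inequality
`(∫_{|x|≤t} |f|^q)^{1/q} ≤ C_{q,p}(t) ‖ξ^D f̂‖_p`. -/
noncomputable def localConst (d : ℕ) (D : ℝ × ℝ) (q p : ℝ≥0∞) (t : ℝ) : ℝ≥0∞ :=
  ⨆ f : {f : SchwartzMap (EuclideanSpace ℝ (Fin d)) ℂ // f ≠ 0},
    eLpNorm (⇑f.1) q (volume.restrict {x | ‖x‖ ≤ t}) /
      eLpNorm (fun ξ => brokenWeight D ξ * ‖𝓕 (⇑f.1) ξ‖) p volume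

open scoped SchwartzMap RealInnerProductSpace

theorem brokenWeight_nonneg {d : ℕ} (A : ℝ × ℝ) (x : EuclideanSpace ℝ (Fin d)) :
    0 ≤ brokenWeight A x := by
  unfold brokenWeight; split_ifs <;> positivity

theorem brokenWeight_pos {d : ℕ} (A : ℝ × ℝ) {x : EuclideanSpace ℝ (Fin d)} (hx : x ≠ 0) :
    0 < brokenWeight A x := by
  unfold brokenWeight; split_ifs <;> positivity

theorem brokenPow_pos (E : ℝ × ℝ) {t : ℝ} (ht : 0 < t) : 0 < brokenPow E t := by
  unfold brokenPow; split_ifs <;> positivity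

theorem measurable_brokenWeight {d : ℕ} (A : ℝ × ℝ) :
    Measurable (brokenWeight A : EuclideanSpace ℝ (Fin d) → ℝ) :=
  Measurable.ite (measurableSet_lt measurable_norm measurable_const)
    (measurable_norm.pow_const _) (measurable_norm.pow_const _)

theorem brokenWeight_le_one_add_norm_sq_rpow {d : ℕ} {A : ℝ × ℝ} (h1 : 0 ≤ A.1) (h2 : 0 ≤ A.2)
    (x : EuclideanSpace ℝ (Fin d)) : brokenWeight A x ≤ (1 + ‖x‖ ^ 2) ^ A.2 := by
  unfold brokenWeight
  split_ifs with h
  · exact (Real.rpow_le_one (norm_nonneg _) h.le h1).trans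
      (Real.one_le_rpow (by nlinarith [sq_nonneg ‖x‖]) h2)
  · exact Real.rpow_le_rpow (norm_nonneg _) (by nlinarith [sq_nonneg (‖x‖ - 1)]) h2

theorem eLpNorm_brokenWeight_mul_lt_top {d : ℕ} {A : ℝ × ℝ} (h1 : 0 ≤ A.1) (h2 : 0 ≤ A.2)
    (p : ℝ≥0∞) (f : 𝓢(EuclideanSpace ℝ (Fin d), ℂ)) :
    eLpNorm (fun x => brokenWeight A x * ‖f x‖) p volume < ∞ := by
  have hw : Function.HasTemperateGrowth
      (fun x : EuclideanSpace ℝ (Fin d) => (1 + ‖x‖ ^ 2) ^ A.2) :=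
    Function.hasTemperateGrowth_one_add_norm_sq_rpow _ A.2
  refine lt_of_le_of_lt (eLpNorm_mono fun x => ?_)
    (SchwartzMap.eLpNorm_lt_top (SchwartzMap.smulLeftCLM ℂ
      (fun x : EuclideanSpace ℝ (Fin d) => (1 + ‖x‖ ^ 2) ^ A.2) f) p volume)
  have hx := brokenWeight_le_one_add_norm_sq_rpow h1 h2 x
  rw [SchwartzMap.smulLeftCLM_apply_apply hw, norm_smul, norm_mul, norm_norm,
    Real.norm_of_nonneg (brokenWeight_nonneg A x), Real.norm_of_nonneg (by positivity)]
  gcongr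

theorem eq_zero_of_eLpNorm_brokenWeight_mul_fourier_eq_zero {d : ℕ} (hd : 1 ≤ d) (A : ℝ × ℝ)
    {p : ℝ≥0∞} (hp : p ≠ 0) (f : 𝓢(EuclideanSpace ℝ (Fin d), ℂ))
    (h : eLpNorm (fun ξ => brokenWeight A ξ * ‖𝓕 (⇑f) ξ‖) p volume = 0) : f = 0 := by
  have : Nonempty (Fin d) := ⟨⟨0, hd⟩⟩
  have hmeas : AEStronglyMeasurable
      (fun ξ : EuclideanSpace ℝ (Fin d) => brokenWeight A ξ * ‖𝓕 (⇑f) ξ‖) volume :=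
    ((measurable_brokenWeight A).mul (𝓕 f).continuous.norm.measurable).aestronglyMeasurable
  rw [eLpNorm_eq_zero_iff hmeas hp] at h
  have hzero : 𝓕 (⇑f) = 0 := by
    refine Continuous.ae_eq_iff_eq volume (𝓕 f).continuous continuous_const |>.1 ?_
    filter_upwards [h, Measure.ae_ne volume (0 : EuclideanSpace ℝ (Fin d))] with ξ hξ h0
    have := (mul_eq_zero.1 hξ).resolve_left (brokenWeight_pos A h0).ne'
    exact norm_eq_zero.1 this
  have hF : 𝓕 f = 0 := DFunLike.coe_injective hzero
  refine (FourierTransform.fourierCLE ℂ 𝓢(EuclideanSpace ℝ (Fin d), ℂ)).map_eq_zero_iff.1 ?_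
  exact hF

/-- The inequality defining `localConst`. -/
theorem eLpNorm_restrict_le_localConst_mul {d : ℕ} (hd : 1 ≤ d) {D : ℝ × ℝ} (h1 : 0 ≤ D.1)
    (h2 : 0 ≤ D.2) (q : ℝ≥0∞) {p : ℝ≥0∞} (hp : p ≠ 0) (t : ℝ)
    (f : 𝓢(EuclideanSpace ℝ (Fin d), ℂ)) :
    eLpNorm f q (volume.restrict {x | ‖x‖ ≤ t}) ≤
      localConst d D q p t * eLpNorm (fun ξ => brokenWeight D ξ * ‖𝓕 (⇑f) ξ‖) p volume := by
  by_cases hf : f = 0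
  · simp [hf]
  have hne : eLpNorm (fun ξ => brokenWeight D ξ * ‖𝓕 (⇑f) ξ‖) p volume ≠ 0 :=
    fun h => hf (eq_zero_of_eLpNorm_brokenWeight_mul_fourier_eq_zero hd D hp f h)
  have hfin : eLpNorm (fun ξ => brokenWeight D ξ * ‖𝓕 (⇑f) ξ‖) p volume ≠ ∞ :=
    (eLpNorm_brokenWeight_mul_lt_top h1 h2 p (𝓕 f)).ne
  rw [← ENNReal.div_le_iff hne hfin]
  exact le_iSup (fun f : {f : 𝓢(EuclideanSpace ℝ (Fin d), ℂ) // f ≠ 0} =>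
    eLpNorm (⇑f.1) q (volume.restrict {x | ‖x‖ ≤ t}) /
      eLpNorm (fun ξ => brokenWeight D ξ * ‖𝓕 (⇑f.1) ξ‖) p volume) ⟨f, hf⟩

/-- The `N`-th finite difference `∑ₖ (-1)ᵏ (N choose k) f(· - k h)` of a Schwartz function. -/
noncomputable def finiteDifference {d : ℕ} (N : ℕ) (h : EuclideanSpace ℝ (Fin d))
    (f : 𝓢(EuclideanSpace ℝ (Fin d), ℂ)) : 𝓢(EuclideanSpace ℝ (Fin d), ℂ) :=
  ∑ k ∈ Finset.range (N + 1),
    ((-1) ^ k * (N.choose k : ℂ)) • SchwartzMap.compSubConstCLM ℂ ((k : ℝ) • h) f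

theorem finiteDifference_apply {d : ℕ} (N : ℕ) (h : EuclideanSpace ℝ (Fin d))
    (f : 𝓢(EuclideanSpace ℝ (Fin d), ℂ)) (x : EuclideanSpace ℝ (Fin d)) :
    finiteDifference N h f x =
      ∑ k ∈ Finset.range (N + 1), ((-1) ^ k * (N.choose k : ℂ)) * f (x - (k : ℝ) • h) := by
  simp [finiteDifference]

theorem fourier_compSubConst {d : ℕ} (a : EuclideanSpace ℝ (Fin d))
    (f : 𝓢(EuclideanSpace ℝ (Fin d), ℂ)) (ξ : EuclideanSpace ℝ (Fin d)) :
    𝓕 (SchwartzMap.compSubConstCLM ℂ a f) ξ =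
      Complex.exp (Complex.I * ((-(2 * Real.pi * ⟪a, ξ⟫) : ℝ) : ℂ)) * 𝓕 f ξ := by
  have h := congrFun (VectorFourier.fourierIntegral_comp_add_right Real.fourierChar volume
    (innerₗ (EuclideanSpace ℝ (Fin d))) f (-a)) ξ
  have e : (⇑f ∘ fun v => v + -a) = ⇑(SchwartzMap.compSubConstCLM ℂ a f) := by
    ext v; simp [sub_eq_add_neg]
  rw [e, Circle.smul_def, Real.fourierChar_apply] at h
  refine h.trans ?_
  rw [smul_eq_mul]
  congr 2
  simp
  ring

theorem fourier_finiteDifference {d : ℕ} (N : ℕ) (h : EuclideanSpace ℝ (Fin d))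
    (f : 𝓢(EuclideanSpace ℝ (Fin d), ℂ)) (ξ : EuclideanSpace ℝ (Fin d)) :
    𝓕 (finiteDifference N h f) ξ =
      (1 - Complex.exp (Complex.I * ((-(2 * Real.pi * ⟪h, ξ⟫) : ℝ) : ℂ))) ^ N * 𝓕 f ξ := by
  have hlin : 𝓕 (finiteDifference N h f) = ∑ k ∈ Finset.range (N + 1),
      ((-1) ^ k * (N.choose k : ℂ)) • 𝓕 (SchwartzMap.compSubConstCLM ℂ ((k : ℝ) • h) f) := by
    simp only [finiteDifference, ← FourierTransform.fourierCLM_apply (R := ℂ), map_sum, map_smul]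
  rw [hlin, sum_apply, sub_eq_neg_add, add_pow, Finset.sum_mul]
  refine Finset.sum_congr rfl fun k _ => ?_
  rw [smul_apply, fourier_compSubConst, neg_pow (Complex.exp _), ← Complex.exp_nat_mul, smul_eq_mul,
    real_inner_smul_left]
  have : Complex.I * ((-(2 * Real.pi * ((k : ℝ) * ⟪h, ξ⟫)) : ℝ) : ℂ) =
      k * (Complex.I * ((-(2 * Real.pi * ⟪h, ξ⟫) : ℝ) : ℂ)) := by
    push_cast; ring
  rw [this]
  ring

theorem norm_one_sub_exp_le {d : ℕ} {t : ℝ} {h : EuclideanSpace ℝ (Fin d)} (hh : ‖h‖ = 2 * t)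
    (ξ : EuclideanSpace ℝ (Fin d)) :
    ‖1 - Complex.exp (Complex.I * ((-(2 * Real.pi * ⟪h, ξ⟫) : ℝ) : ℂ))‖ ≤
      4 * Real.pi * min 1 (t * ‖ξ‖) := by
  rw [norm_sub_rev, mul_min_of_nonneg _ _ (by positivity)]
  refine le_min ?_ ?_
  · rw [Complex.norm_exp_I_mul_ofReal_sub_one, norm_mul, Real.norm_eq_abs, Real.norm_eq_abs,
      abs_two]
    nlinarith [Real.abs_sin_le_one (-(2 * Real.pi * ⟪h, ξ⟫) / 2), Real.pi_gt_three]
  · refine Real.norm_exp_I_mul_ofReal_sub_one_le.trans ?_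
    have := abs_real_inner_le_norm h ξ
    rw [hh] at this
    rw [Real.norm_eq_abs, abs_neg, abs_mul, abs_of_pos (by positivity : 0 < 2 * Real.pi)]
    nlinarith [Real.pi_pos]

/-- A high-pass multiplier vanishing to high order at frequencies below `1 / t` trades the
weight `ξ^D` for `t^{L^T} ξ^B`, where `L = B - D`. -/
theorem min_pow_mul_brokenWeight_le {d : ℕ} {B D : ℝ × ℝ} (h1 : D.1 ≤ B.1) (h2 : D.2 ≤ B.2)
    {N : ℕ} (hN : N ≠ 0) (hN1 : B.1 - D.1 ≤ N) (hN2 : B.2 - D.2 ≤ N) {t : ℝ} (ht : 0 < t)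
    (ξ : EuclideanSpace ℝ (Fin d)) :
    min 1 (t * ‖ξ‖) ^ N * brokenWeight D ξ ≤
      brokenPow (B.2 - D.2, B.1 - D.1) t * brokenWeight B ξ := by
  rcases eq_or_ne ξ 0 with rfl | hξ
  · rw [norm_zero, mul_zero, min_eq_right zero_le_one, zero_pow hN, zero_mul]
    exact mul_nonneg (brokenPow_pos _ ht).le (brokenWeight_nonneg _ _)
  have hs : 0 < ‖ξ‖ := norm_pos_iff.2 hξ
  have hm0 : 0 < min 1 (t * ‖ξ‖) := lt_min one_pos (by positivity)
  have key : ∀ r : ℝ, 0 ≤ r → r ≤ N → min 1 (t * ‖ξ‖) ^ N ≤ t ^ r * ‖ξ‖ ^ r := by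
    intro r hr hrN
    rw [← Real.rpow_natCast, ← Real.mul_rpow ht.le hs.le]
    exact (Real.rpow_le_rpow_of_exponent_ge hm0 (min_le_left _ _) hrN).trans
      (Real.rpow_le_rpow hm0.le (min_le_right _ _) hr)
  have split : ∀ b c : ℝ, ‖ξ‖ ^ b = ‖ξ‖ ^ (b - c) * ‖ξ‖ ^ c := by
    intro b c
    rw [← Real.rpow_add hs, sub_add_cancel]
  unfold brokenPow brokenWeight
  split_ifs with hξ1 ht1 ht1
  · rw [split B.1 D.1, ← mul_assoc]
    gcongr
    have hpow := key N N.cast_nonneg le_rfl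
    refine hpow.trans (mul_le_mul ?_ ?_ (by positivity) (by positivity))
    · exact Real.rpow_le_rpow_of_exponent_ge ht ht1.le hN2
    · exact Real.rpow_le_rpow_of_exponent_ge hs hξ1.le hN1
  · rw [split B.1 D.1, ← mul_assoc]
    gcongr
    exact key _ (sub_nonneg.2 h1) hN1
  · rw [split B.2 D.2, ← mul_assoc]
    gcongr
    exact key _ (sub_nonneg.2 h2) hN2
  · rw [split B.2 D.2, ← mul_assoc]
    gcongr
    calc min 1 (t * ‖ξ‖) ^ N ≤ 1 := pow_le_one₀ hm0.le (min_le_left _ _)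
      _ ≤ t ^ (B.1 - D.1) * ‖ξ‖ ^ (B.2 - D.2) :=
        one_le_mul_of_one_le_of_one_le
          (Real.one_le_rpow (not_lt.1 ht1) (sub_nonneg.2 h1))
          (Real.one_le_rpow (not_lt.1 hξ1) (sub_nonneg.2 h2))

theorem eLpNorm_brokenWeight_fourier_finiteDifference_le {d : ℕ} {B D : ℝ × ℝ}
    (h1 : D.1 ≤ B.1) (h2 : D.2 ≤ B.2) {N : ℕ} (hN : N ≠ 0) (hN1 : B.1 - D.1 ≤ N)
    (hN2 : B.2 - D.2 ≤ N) {t : ℝ} (ht : 0 < t) {h : EuclideanSpace ℝ (Fin d)}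
    (hh : ‖h‖ = 2 * t) (p : ℝ≥0∞) (f : 𝓢(EuclideanSpace ℝ (Fin d), ℂ)) :
    eLpNorm (fun ξ => brokenWeight D ξ * ‖𝓕 (⇑(finiteDifference N h f)) ξ‖) p volume ≤
      ENNReal.ofReal ((4 * Real.pi) ^ N) *
        (ENNReal.ofReal (brokenPow (B.2 - D.2, B.1 - D.1) t) *
          eLpNorm (fun ξ => brokenWeight B ξ * ‖𝓕 (⇑f) ξ‖) p volume) := by
  rw [← mul_assoc, ← ENNReal.ofReal_mul (by positivity)]
  refine eLpNorm_le_mul_eLpNorm_of_ae_le_mul (Filter.Eventually.of_forall fun ξ => ?_) p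
  rw [norm_mul, norm_mul, norm_norm, norm_norm, Real.norm_of_nonneg (brokenWeight_nonneg _ _),
    Real.norm_of_nonneg (brokenWeight_nonneg _ _), ← SchwartzMap.fourier_coe,
    fourier_finiteDifference, norm_mul, norm_pow, ← SchwartzMap.fourier_coe]
  have hmult := pow_le_pow_left₀ (norm_nonneg _) (norm_one_sub_exp_le hh ξ) N
  rw [mul_pow] at hmult
  have hweight := min_pow_mul_brokenWeight_le h1 h2 hN hN1 hN2 ht ξ
  have hD := brokenWeight_nonneg D ξ
  calc _ ≤ brokenWeight D ξ *
        ((4 * Real.pi) ^ N * min 1 (t * ‖ξ‖) ^ N * ‖𝓕 f ξ‖) := by gcongr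
    _ = (4 * Real.pi) ^ N * (min 1 (t * ‖ξ‖) ^ N * brokenWeight D ξ) * ‖𝓕 f ξ‖ := by ring
    _ ≤ (4 * Real.pi) ^ N * (brokenPow (B.2 - D.2, B.1 - D.1) t * brokenWeight B ξ) *
        ‖𝓕 f ξ‖ := by gcongr
    _ = _ := by ring

theorem eLpNorm_restrict_outside_le {d : ℕ} {A : ℝ × ℝ} (h1 : 0 ≤ A.1) (h2 : 0 ≤ A.2)
    (q : ℝ≥0∞) {t : ℝ} (ht : 0 < t) (f : EuclideanSpace ℝ (Fin d) → ℂ) :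
    eLpNorm f q (volume.restrict {x | t ≤ ‖x‖}) ≤
      ENNReal.ofReal (brokenPow (-A.1, -A.2) t) *
        eLpNorm (fun x => brokenWeight A x * ‖f x‖) q volume := by
  refine (eLpNorm_le_mul_eLpNorm_of_ae_le_mul (g := fun x => brokenWeight A x * ‖f x‖) ?_ q).trans
    (mul_le_mul_right (eLpNorm_restrict_le _ _ _ _) _)
  refine (ae_restrict_iff' (measurableSet_le measurable_const measurable_norm)).2
    (Filter.Eventually.of_forall fun x hx => ?_)
  have hx : t ≤ ‖x‖ := hx
  rw [norm_mul, norm_norm, Real.norm_of_nonneg (brokenWeight_nonneg _ _), ← mul_assoc]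
  refine le_mul_of_one_le_left (norm_nonneg _) ?_
  unfold brokenPow brokenWeight
  have cancel : ∀ a : ℝ, t ^ (-a) * t ^ a = 1 := fun a => by
    rw [← Real.rpow_add ht, neg_add_cancel, Real.rpow_zero]
  split_ifs with ht1 hx1 hx1
  · rw [← cancel A.1]
    gcongr
  · exact one_le_mul_of_one_le_of_one_le
      (Real.one_le_rpow_of_pos_of_le_one_of_nonpos ht ht1.le (neg_nonpos.2 h1))
      (Real.one_le_rpow (not_lt.1 hx1) h2)
  · exact absurd (hx.trans_lt hx1) ht1
  · rw [← cancel A.2]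
    gcongr

theorem eLpNorm_translate_restrict_ball_le {d : ℕ} (q : ℝ≥0∞) {t : ℝ}
    {a : EuclideanSpace ℝ (Fin d)} (ha : 2 * t ≤ ‖a‖) (f : 𝓢(EuclideanSpace ℝ (Fin d), ℂ)) :
    eLpNorm (fun x => f (x - a)) q (volume.restrict {x | ‖x‖ ≤ t}) ≤
      eLpNorm f q (volume.restrict {x | t ≤ ‖x‖}) := by
  have hball : MeasurableSet {x : EuclideanSpace ℝ (Fin d) | ‖x‖ ≤ t} :=
    measurableSet_le measurable_norm measurable_const
  have hout : MeasurableSet {x : EuclideanSpace ℝ (Fin d) | t ≤ ‖x‖} :=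
    measurableSet_le measurable_const measurable_norm
  have hmp := (measurePreserving_sub_right (volume : Measure (EuclideanSpace ℝ (Fin d))) a
    ).restrict_preimage hout
  rw [← eLpNorm_comp_measurePreserving f.continuous.aestronglyMeasurable hmp]
  refine eLpNorm_mono_measure _ (Measure.restrict_mono (fun x hx => ?_) le_rfl)
  have hx : ‖x‖ ≤ t := hx
  change t ≤ ‖x - a‖
  rw [norm_sub_rev]
  linarith [norm_sub_norm_le a x]

theorem eLpNorm_restrict_ball_le_finiteDifference_add {d : ℕ} {q : ℝ≥0∞} (hq : 1 ≤ q) (N : ℕ)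
    {t : ℝ} (ht : 0 < t) {h : EuclideanSpace ℝ (Fin d)} (hh : ‖h‖ = 2 * t)
    (f : 𝓢(EuclideanSpace ℝ (Fin d), ℂ)) :
    eLpNorm f q (volume.restrict {x | ‖x‖ ≤ t}) ≤
      eLpNorm (finiteDifference N h f) q (volume.restrict {x | ‖x‖ ≤ t}) +
        ENNReal.ofReal (2 ^ N - 1) * eLpNorm f q (volume.restrict {x | t ≤ ‖x‖}) := by
  set μ := (volume : Measure (EuclideanSpace ℝ (Fin d))).restrict {x | ‖x‖ ≤ t}
  set c : ℕ → ℂ := fun k => (-1) ^ (k + 1) * (N.choose (k + 1) : ℂ)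
  set F : ℕ → EuclideanSpace ℝ (Fin d) → ℂ :=
    fun k => c k • fun x => f (x - ((k + 1 : ℕ) : ℝ) • h)
  have hF : ∀ k, AEStronglyMeasurable (F k) μ := fun k =>
    (continuous_const.mul (f.continuous.comp (continuous_sub_right _))).aestronglyMeasurable
  have heq : ⇑f = ⇑(finiteDifference N h f) - ∑ k ∈ Finset.range N, F k := by
    ext x
    simp [finiteDifference_apply, Finset.sum_range_succ', F, c]
  have hFle : ∀ k, eLpNorm (F k) q μ ≤ ENNReal.ofReal (N.choose (k + 1)) *
      eLpNorm f q (volume.restrict {x | t ≤ ‖x‖}) := fun k => by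
    rw [eLpNorm_const_smul]
    refine mul_le_mul' ?_ (eLpNorm_translate_restrict_ball_le q ?_ f)
    · rw [← ofReal_norm]
      simp [c]
    · rw [norm_smul, hh, Real.norm_natCast]
      push_cast
      nlinarith [(Nat.cast_nonneg k : (0 : ℝ) ≤ k)]
  have hchoose : ∑ k ∈ Finset.range N, (N.choose (k + 1) : ℝ) = 2 ^ N - 1 := by
    have := Nat.sum_range_choose N
    rw [Finset.sum_range_succ', Nat.choose_zero_right] at this
    have : (∑ k ∈ Finset.range N, (N.choose (k + 1) : ℝ)) + 1 = 2 ^ N := by exact_mod_cast this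
    linarith
  calc eLpNorm f q μ
      = eLpNorm (⇑(finiteDifference N h f) - ∑ k ∈ Finset.range N, F k) q μ := by rw [← heq]
    _ ≤ eLpNorm (finiteDifference N h f) q μ + eLpNorm (∑ k ∈ Finset.range N, F k) q μ :=
        eLpNorm_sub_le (finiteDifference N h f).continuous.aestronglyMeasurable
          (Finset.aestronglyMeasurable_sum _ fun k _ => hF k) hq
    _ ≤ eLpNorm (finiteDifference N h f) q μ + ∑ k ∈ Finset.range N, eLpNorm (F k) q μ := by
        gcongr
        exact eLpNorm_sum_le (fun k _ => hF k) hq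
    _ ≤ _ := by
        rw [← hchoose, ENNReal.ofReal_sum_of_nonneg fun k _ => Nat.cast_nonneg _, Finset.sum_mul]
        gcongr with k
        exact hFle k

theorem eLpNorm_le_restrict_ball_add_outside {d : ℕ} {q : ℝ≥0∞} (hq : 1 ≤ q) (t : ℝ)
    (f : 𝓢(EuclideanSpace ℝ (Fin d), ℂ)) :
    eLpNorm f q volume ≤ eLpNorm f q (volume.restrict {x | ‖x‖ ≤ t}) +
      eLpNorm f q (volume.restrict {x | t ≤ ‖x‖}) := by
  have hball : MeasurableSet {x : EuclideanSpace ℝ (Fin d) | ‖x‖ ≤ t} :=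
    measurableSet_le measurable_norm measurable_const
  have hf := f.continuous.aestronglyMeasurable (μ := volume)
  calc eLpNorm f q volume
      = eLpNorm ({x | ‖x‖ ≤ t}.indicator f + {x | ‖x‖ ≤ t}ᶜ.indicator f) q volume := by
        rw [Set.indicator_self_add_compl]
    _ ≤ _ := eLpNorm_add_le (hf.indicator hball) (hf.indicator hball.compl) hq
    _ ≤ _ := by
        rw [eLpNorm_indicator_eq_eLpNorm_restrict hball,
          eLpNorm_indicator_eq_eLpNorm_restrict hball.compl]
        gcongr
        exact fun x (hx : ¬ ‖x‖ ≤ t) => (not_le.1 hx).le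

/-- Lemma 3.1: `‖f‖_q ≲ C_{q,p}(t) t^{L^T} ‖ξ^B f̂‖_p + t^{−A} ‖x^A f‖_q` for all `t > 0`,
where `L = B − D` and `0 ≤ D ≤ B`. -/
theorem local_uncertainty_splitting
    (d : ℕ) (hd : 1 ≤ d) (p q : ℝ≥0∞) (hp : 1 ≤ p) (hq : 1 ≤ q) (hq' : q ≠ ∞)
    (A B D L : ℝ × ℝ) (hA1 : 0 ≤ A.1) (hA2 : 0 ≤ A.2)
    (hD1 : 0 ≤ D.1) (hD2 : 0 ≤ D.2) (hDB1 : D.1 ≤ B.1) (hDB2 : D.2 ≤ B.2)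
    (hL : L = (B.1 - D.1, B.2 - D.2)) :
    ∃ c : ℝ, 0 < c ∧
      ∀ f : SchwartzMap (EuclideanSpace ℝ (Fin d)) ℂ, ∀ t : ℝ, 0 < t →
        eLpNorm (⇑f) q volume ≤ ENNReal.ofReal c *
          (localConst d D q p t * ENNReal.ofReal (brokenPow (L.2, L.1) t) *
              eLpNorm (fun ξ => brokenWeight B ξ * ‖𝓕 (⇑f) ξ‖) p volume +
            ENNReal.ofReal (brokenPow (-A.1, -A.2) t) *
              eLpNorm (fun x => brokenWeight A x * ‖f x‖) q volume) := by
  subst hL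
  obtain ⟨M, hM⟩ := exists_nat_ge (max (B.1 - D.1) (B.2 - D.2))
  set N := M + 1
  have hMN : (M : ℝ) ≤ N := by exact_mod_cast M.le_succ
  have hN1 : B.1 - D.1 ≤ N := (le_max_left _ _).trans (hM.trans hMN)
  have hN2 : B.2 - D.2 ≤ N := (le_max_right _ _).trans (hM.trans hMN)
  refine ⟨(4 * Real.pi) ^ N, by positivity, fun f t ht => ?_⟩
  have : Nonempty (Fin d) := ⟨⟨0, hd⟩⟩
  obtain ⟨h, hh⟩ := exists_norm_eq (EuclideanSpace ℝ (Fin d)) (by positivity : 0 ≤ 2 * t)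
  have hlocal := eLpNorm_restrict_le_localConst_mul hd hD1 hD2 q (one_pos.trans_le hp).ne' t
    (finiteDifference N h f)
  have hfourier := eLpNorm_brokenWeight_fourier_finiteDifference_le hDB1 hDB2 M.succ_ne_zero
    hN1 hN2 ht hh p f
  have houtside := eLpNorm_restrict_outside_le hA1 hA2 q ht f
  set T := eLpNorm f q (volume.restrict {x | t ≤ ‖x‖})
  have hpow : (2 : ℝ) ^ N ≤ (4 * Real.pi) ^ N :=
    pow_le_pow_left₀ two_pos.le (by nlinarith [Real.pi_gt_three]) N
  calc eLpNorm f q volume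
      ≤ eLpNorm (finiteDifference N h f) q (volume.restrict {x | ‖x‖ ≤ t}) +
          ENNReal.ofReal (2 ^ N - 1) * T + T :=
        (eLpNorm_le_restrict_ball_add_outside hq t f).trans
          (add_le_add_left (eLpNorm_restrict_ball_le_finiteDifference_add hq N ht hh f) _)
    _ = eLpNorm (finiteDifference N h f) q (volume.restrict {x | ‖x‖ ≤ t}) +
          ENNReal.ofReal (2 ^ N) * T := by
        rw [add_assoc, ← add_one_mul, ← ENNReal.ofReal_one, ← ENNReal.ofReal_add
          (sub_nonneg.2 (one_le_pow₀ one_le_two)) zero_le_one, sub_add_cancel]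
    _ ≤ localConst d D q p t * (ENNReal.ofReal ((4 * Real.pi) ^ N) *
          (ENNReal.ofReal (brokenPow (B.2 - D.2, B.1 - D.1) t) *
            eLpNorm (fun ξ => brokenWeight B ξ * ‖𝓕 (⇑f) ξ‖) p volume)) +
          ENNReal.ofReal ((4 * Real.pi) ^ N) * (ENNReal.ofReal (brokenPow (-A.1, -A.2) t) *
            eLpNorm (fun x => brokenWeight A x * ‖f x‖) q volume) :=
        add_le_add (hlocal.trans (by gcongr))
          (mul_le_mul' (ENNReal.ofReal_le_ofReal hpow) houtside)
    _ = _ := by ring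
end
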